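/- arXiv:2408.00345 — 2 statements merged into one kernel-verified Lean document; each statement's English description precedes it below -/
import Mathlib

section
/- Let c_0 = (c_{0i})_{i≥0} ∈ X_{0,1}^+ and assume the rate coefficients satisfy the growth condition (GB). Then the initial value problem for the isolated DGED system with initial datum c_0 has at least one global mild solution c defined on the interval [0,∞). -/
open Finset MeasureTheory

/-- Infinite-system operator `Q_{1,i}`. -/
noncomputable def Qi1 (a : ℕ → ℕ → ℕ → ℝ) (c : ℕ → ℝ) (i : ℕ) : ℝ :=
  ∑' p : ℕ × ℕ, if 1 ≤ p.1 then a (i + p.1) p.2 p.1 * c (i + p.1) * c p.2 else 0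

/-- Infinite-system operator `Q_{2,i}`. -/
noncomputable def Qi2 (a : ℕ → ℕ → ℕ → ℝ) (c : ℕ → ℝ) (i : ℕ) : ℝ :=
  -∑' p : ℕ × ℕ, if 1 ≤ p.1 ∧ p.1 ≤ p.2 then a p.2 i p.1 * c p.2 * c i else 0

/-- Infinite-system operator `Q_{3,i}` (equal to `0` when `i = 0`). -/
noncomputable def Qi3 (a : ℕ → ℕ → ℕ → ℝ) (c : ℕ → ℝ) (i : ℕ) : ℝ :=
  ∑ k ∈ Finset.Icc 1 i, ∑' j : ℕ, if k ≤ j then a j (i - k) k * c j * c (i - k) else 0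

/-- Infinite-system operator `Q_{4,i}` (equal to `0` when `i = 0`). -/
noncomputable def Qi4 (a : ℕ → ℕ → ℕ → ℝ) (c : ℕ → ℝ) (i : ℕ) : ℝ :=
  -∑ k ∈ Finset.Icc 1 i, ∑' j : ℕ, a i j k * c j * c i

/-- Summability of all the series defining the operators `Q_{j,i}`. -/
def QSummable (a : ℕ → ℕ → ℕ → ℝ) (c : ℕ → ℝ) (i : ℕ) : Prop :=
  Summable (fun p : ℕ × ℕ =>
    if 1 ≤ p.1 then a (i + p.1) p.2 p.1 * c (i + p.1) * c p.2 else 0) ∧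
  Summable (fun p : ℕ × ℕ =>
    if 1 ≤ p.1 ∧ p.1 ≤ p.2 then a p.2 i p.1 * c p.2 * c i else 0) ∧
  (∀ k ∈ Finset.Icc 1 i,
    Summable (fun j : ℕ => if k ≤ j then a j (i - k) k * c j * c (i - k) else 0)) ∧
  (∀ k ∈ Finset.Icc 1 i, Summable (fun j : ℕ => a i j k * c j * c i))

/-- `c` is a mild solution of the isolated DGED system on the set `S` with
initial datum `c0 ∈ X_{0,1}^+`. -/
def MildSolIso (a : ℕ → ℕ → ℕ → ℝ) (c0 : ℕ → ℝ) (S : Set ℝ) (c : ℕ → ℝ → ℝ) : Prop :=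
  (∀ i, c i 0 = c0 i) ∧
  (∀ t ∈ S, (∀ i, 0 ≤ c i t) ∧ Summable (fun i : ℕ => (1 + (i : ℝ)) * c i t)) ∧
  (∀ i, ContinuousOn (c i) S) ∧
  (∀ i : ℕ, ∀ t ∈ S,
    (∀ᵐ s ∂(volume.restrict (Set.Ioc 0 t)), QSummable a (fun n => c n s) i) ∧
    IntegrableOn (fun s => Qi1 a (fun n => c n s) i) (Set.Ioc 0 t) ∧
    IntegrableOn (fun s => Qi2 a (fun n => c n s) i) (Set.Ioc 0 t) ∧
    IntegrableOn (fun s => Qi3 a (fun n => c n s) i) (Set.Ioc 0 t) ∧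
    IntegrableOn (fun s => Qi4 a (fun n => c n s) i) (Set.Ioc 0 t) ∧
    c i t = c0 i + ∫ s in (0 : ℝ)..t,
      (Qi1 a (fun n => c n s) i + Qi2 a (fun n => c n s) i +
        Qi3 a (fun n => c n s) i + Qi4 a (fun n => c n s) i))

/-- `c` is a mild solution of the non-isolated DGED system on the set `S` with
initial datum `c0 ∈ X_{0,1}^+`: the concentration of `0`-clusters is constant and the
components `c_i`, `i ≥ 1`, satisfy the integral equations. -/
def MildSolNon (a : ℕ → ℕ → ℕ → ℝ) (c0 : ℕ → ℝ) (S : Set ℝ) (c : ℕ → ℝ → ℝ) : Prop :=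
  (∀ i, c i 0 = c0 i) ∧
  (∀ t ∈ S, (∀ i, 0 ≤ c i t) ∧ Summable (fun i : ℕ => (1 + (i : ℝ)) * c i t)) ∧
  (∀ i, ContinuousOn (c i) S) ∧
  (∀ t ∈ S, c 0 t = c0 0) ∧
  (∀ i : ℕ, 1 ≤ i → ∀ t ∈ S,
    (∀ᵐ s ∂(volume.restrict (Set.Ioc 0 t)), QSummable a (fun n => c n s) i) ∧
    IntegrableOn (fun s => Qi1 a (fun n => c n s) i) (Set.Ioc 0 t) ∧
    IntegrableOn (fun s => Qi2 a (fun n => c n s) i) (Set.Ioc 0 t) ∧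
    IntegrableOn (fun s => Qi3 a (fun n => c n s) i) (Set.Ioc 0 t) ∧
    IntegrableOn (fun s => Qi4 a (fun n => c n s) i) (Set.Ioc 0 t) ∧
    c i t = c0 i + ∫ s in (0 : ℝ)..t,
      (Qi1 a (fun n => c n s) i + Qi2 a (fun n => c n s) i +
        Qi3 a (fun n => c n s) i + Qi4 a (fun n => c n s) i))

/-- Growth condition (GB) on the rate coefficients. -/
def GB (a : ℕ → ℕ → ℕ → ℝ) (C Q : ℝ) (q : ℕ → ℕ → ℝ) : Prop :=
  1 ≤ C ∧ 1 ≤ Q ∧ (∀ i k, 0 ≤ q i k) ∧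
  (∀ i : ℕ, 1 ≤ i →
    ∑ k ∈ Finset.Icc 1 i, (k : ℝ) * ((i : ℝ) - k + 1) * q i k ≤ Q * i) ∧
  (∀ i j k : ℕ, 1 ≤ k → k ≤ i → 1 ≤ j →
    a i j k ≤ C * ((i : ℝ) - k + 1) * ((j : ℝ) + k) * q i k)


lemma exists_weight (c0 : ℕ → ℝ) (hc0 : ∀ i, 0 ≤ c0 i)
    (hX : Summable (fun i : ℕ => (1 + (i : ℝ)) * c0 i)) :
    ∃ h : ℕ → ℝ, (∀ n, 1 ≤ h n) ∧ Monotone h ∧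
      (∀ x y : ℕ, (y : ℝ) * h (x + y) ≤ ((x : ℝ) + y) * h y) ∧
      Filter.Tendsto h Filter.atTop Filter.atTop ∧
      Summable (fun i : ℕ => (i : ℝ) * h i * c0 i) := by
  have hX1 : Summable (fun i : ℕ => (i : ℝ) * c0 i) := by
    refine Summable.of_nonneg_of_le (fun i => mul_nonneg (by positivity) (hc0 i)) (fun i => ?_) hX
    nlinarith [hc0 i]
  have hlim : Filter.Tendsto
      (fun N : ℕ => ∑' i : ℕ, (min 1 ((i : ℝ) / N)) * ((i : ℝ) * c0 i)) Filter.atTop (nhds 0) := by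
    have := tendsto_tsum_of_dominated_convergence (𝓕 := Filter.atTop)
      (f := fun (N : ℕ) (i : ℕ) => (min 1 ((i : ℝ) / N)) * ((i : ℝ) * c0 i))
      (g := fun _ => (0 : ℝ)) (bound := fun i : ℕ => (i : ℝ) * c0 i) hX1 ?_ ?_
    · simpa using this
    · intro i
      have h1 : Filter.Tendsto (fun N : ℕ => (i : ℝ) / N) Filter.atTop (nhds 0) :=
        tendsto_const_div_atTop_nhds_zero_nat _
      have h2 : Filter.Tendsto (fun N : ℕ => min 1 ((i : ℝ) / N)) Filter.atTop (nhds (min 1 0)) :=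
        tendsto_const_nhds.min h1
      have h3 := h2.mul_const ((i : ℝ) * c0 i)
      simpa using h3
    · refine Filter.Eventually.of_forall fun N i => ?_
      have h0 : 0 ≤ (i : ℝ) * c0 i := mul_nonneg (by positivity) (hc0 i)
      have h1 : 0 ≤ min 1 ((i : ℝ) / N) := le_min (by norm_num) (by positivity)
      rw [Real.norm_of_nonneg (mul_nonneg h1 h0)]
      exact mul_le_of_le_one_left h0 (min_le_left _ _)
  have hch : ∀ m : ℕ, ∃ N : ℕ, 2 ^ m ≤ N ∧
      ∑' i : ℕ, (min 1 ((i : ℝ) / N)) * ((i : ℝ) * c0 i) ≤ (1 / 2 : ℝ) ^ m := by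
    intro m
    have h1 := (hlim.eventually (gt_mem_nhds (show (0:ℝ) < (1/2:ℝ)^m by positivity)))
    obtain ⟨N, hN⟩ := (h1.and (Filter.eventually_ge_atTop (2 ^ m))).exists
    exact ⟨N, hN.2, hN.1.le⟩
  choose N hN2 hN using hch
  have hNpos : ∀ m, (0 : ℝ) < N m := fun m => by
    have : 0 < N m := lt_of_lt_of_le (by positivity) (hN2 m)
    exact_mod_cast this
  set f : ℕ → ℕ → ℝ := fun n m => min 1 ((n : ℝ) / N m) with hf
  have hf0 : ∀ n m, 0 ≤ f n m := fun n m => le_min (by norm_num) (by positivity)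
  have hgeo : Summable (fun m : ℕ => (1/2 : ℝ) ^ m) := summable_geometric_two
  have hfs : ∀ n, Summable (f n) := by
    intro n
    refine Summable.of_nonneg_of_le (hf0 n) (fun m => ?_) (hgeo.mul_left (n : ℝ))
    refine (min_le_right _ _).trans ?_
    rw [div_eq_mul_inv, one_div, inv_pow]
    have : (2 : ℝ) ^ m ≤ N m := by exact_mod_cast hN2 m
    gcongr
  refine ⟨fun n => 1 + ∑' m, f n m, fun n => ?_, ?_, ?_, ?_, ?_⟩
  · have : 0 ≤ ∑' m, f n m := tsum_nonneg (hf0 n)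
    linarith
  · intro n n' hnn
    have : ∑' m, f n m ≤ ∑' m, f n' m := by
      refine Summable.tsum_le_tsum (fun m => ?_) (hfs n) (hfs n')
      exact min_le_min_left _ (by have := (hNpos m).le; gcongr)
    simpa using this
  · intro x y
    have : (y : ℝ) * ∑' m, f (x + y) m ≤ ((x : ℝ) + y) * ∑' m, f y m := by
      rw [← tsum_mul_left, ← tsum_mul_left]
      refine Summable.tsum_le_tsum (fun m => ?_) ((hfs _).mul_left _) ((hfs _).mul_left _)
      simp only [hf]
      have hp := hNpos m
      have hx : (0:ℝ) ≤ x := by positivity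
      have hy : (0:ℝ) ≤ y := by positivity
      rw [mul_min_of_nonneg _ _ (by positivity : (0:ℝ) ≤ (x:ℝ) + y)]
      refine le_min ?_ ?_
      · have := min_le_left (1:ℝ) (((x + y : ℕ) : ℝ) / N m)
        nlinarith
      · have := min_le_right (1:ℝ) (((x + y : ℕ) : ℝ) / N m)
        calc (y : ℝ) * min 1 (((x + y : ℕ) : ℝ) / N m) ≤ y * (((x + y : ℕ) : ℝ) / N m) := by gcongr
          _ = _ := by push_cast; ring
    have hx : (0:ℝ) ≤ x := by positivity
    nlinarith
  · refine Filter.tendsto_atTop.2 fun b => ?_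
    obtain ⟨K, hK⟩ := exists_nat_ge b
    filter_upwards [Filter.eventually_ge_atTop (∑ m ∈ range K, N m)] with n hn
    have h1 : ∑ m ∈ range K, f n m ≤ ∑' m, f n m := (hfs n).sum_le_tsum _ (fun m _ => hf0 n m)
    have h2 : ∑ m ∈ range K, f n m = K := by
      rw [Finset.sum_congr rfl (g := fun _ => (1 : ℝ))]
      · simp
      · intro m hm
        have h3 : N m ≤ n := (Finset.single_le_sum (f := N) (fun _ _ => Nat.zero_le _) hm).trans hn
        have h4 : (N m : ℝ) ≤ n := by exact_mod_cast h3
        exact min_eq_left ((one_le_div (hNpos m)).2 h4)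
    linarith
  · have hs : Summable (fun i : ℕ => (∑' m, f i m) * ((i : ℝ) * c0 i)) := by
      have hp0 : ∀ i : ℕ, 0 ≤ (i : ℝ) * c0 i := fun i => mul_nonneg (by positivity) (hc0 i)
      refine summable_of_sum_le (c := ∑' m : ℕ, (1/2:ℝ)^m)
        (fun i => mul_nonneg (tsum_nonneg (hf0 i)) (hp0 i)) (fun S => ?_)
      simp_rw [← tsum_mul_right]
      rw [← Summable.tsum_finsetSum (fun i _ => (hfs i).mul_right _)]
      refine Summable.tsum_le_tsum (fun m => ?_)
        (summable_sum (fun i _ => (hfs i).mul_right _)) hgeo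
      refine le_trans ?_ (hN m)
      refine Summable.sum_le_tsum (f := fun i : ℕ => f i m * ((i : ℝ) * c0 i)) S
        (fun i _ => mul_nonneg (hf0 i m) (hp0 i)) ?_
      refine Summable.of_nonneg_of_le (fun i => mul_nonneg (hf0 i m) (hp0 i)) (fun i => ?_) hX1
      exact mul_le_of_le_one_left (hp0 i) (min_le_left _ _)
    refine (hX1.add hs).congr (fun i => ?_)
    ring

open Finset MeasureTheory

/-- event density -/
noncomputable def wE (a : ℕ → ℕ → ℕ → ℝ) (x : ℕ → ℝ) (e : ℕ × ℕ × ℕ) : ℝ :=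
  if 1 ≤ e.2.2 ∧ e.2.2 ≤ e.1 then a e.1 e.2.1 e.2.2 * x e.1 * x e.2.1 else 0

/-- change of the test function `g` in an event -/
noncomputable def sg (g : ℕ → ℝ) (e : ℕ × ℕ × ℕ) : ℝ :=
  g (e.1 - e.2.2) + g (e.2.1 + e.2.2) - g e.1 - g e.2.1

/-- finite box of events -/
def ebox (n : ℕ) : Finset (ℕ × ℕ × ℕ) := range (n + 1) ×ˢ range (n + 1) ×ˢ range (n + 1)

lemma mem_ebox (n i j k : ℕ) : (i, j, k) ∈ ebox n ↔ i ≤ n ∧ j ≤ n ∧ k ≤ n := by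
  simp [ebox]

lemma wE_nonneg {a : ℕ → ℕ → ℕ → ℝ} (ha : ∀ i j k, 0 ≤ a i j k) {x : ℕ → ℝ} (hx : ∀ i, 0 ≤ x i)
    (e : ℕ × ℕ × ℕ) : 0 ≤ wE a x e := by
  unfold wE
  split_ifs
  · exact mul_nonneg (mul_nonneg (ha _ _ _) (hx _)) (hx _)
  · exact le_rfl

lemma sum_le_of_hasSum_nonneg {f : ℕ → ℝ} {s : ℝ} (hf : ∀ i, 0 ≤ f i) (hs : HasSum f s)
    (S : Finset ℕ) : ∑ i ∈ S, f i ≤ s := sum_le_hasSum S (fun i _ => hf i) hs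

lemma key_sum {a : ℕ → ℕ → ℕ → ℝ} {C Q : ℝ} {q : ℕ → ℕ → ℝ} (hGB : GB a C Q q)
    {h : ℕ → ℝ} (h1 : ∀ n, 1 ≤ h n) {A : ℝ} (hA : 0 ≤ A) (Θ : ℕ × ℕ × ℕ → ℝ)
    (hΘ : ∀ i j k : ℕ, 1 ≤ k → k ≤ i →
      a i j k * Θ (i, j, k) ≤ A * ((k : ℝ) * ((i : ℝ) - k + 1) * q i k) * ((j : ℝ) * (h i + h j)))
    {x : ℕ → ℝ} (hx : ∀ i, 0 ≤ x i) {M H : ℝ}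
    (hM : HasSum (fun i : ℕ => (1 + (i : ℝ)) * x i) M)
    (hH : HasSum (fun i : ℕ => (i : ℝ) * h i * x i) H) (n : ℕ) :
    ∑ e ∈ ebox n, wE a x e * Θ e ≤ 2 * A * Q * M * H := by
  obtain ⟨hC, hQ, hq, hqs, -⟩ := hGB
  have hin : ∀ i j : ℕ, ∑ k ∈ range (n + 1), wE a x (i, j, k) * Θ (i, j, k) ≤
      A * Q * ((i : ℝ) * x i * ((j : ℝ) * x j) * (h i + h j)) := by
    intro i j
    set T : ℕ → ℝ := fun k => ((k : ℝ) * ((i : ℝ) - k + 1) * q i k) *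
      (A * ((j : ℝ) * (h i + h j)) * (x i * x j)) with hT
    have hP : 0 ≤ A * ((j : ℝ) * (h i + h j)) * (x i * x j) := by
      have := h1 i; have := h1 j; have := hx i; have := hx j
      have : 0 ≤ h i + h j := by linarith
      positivity
    have hT0 : ∀ k ∈ Icc 1 i, 0 ≤ T k := by
      intro k hk
      rw [mem_Icc] at hk
      have : (k : ℝ) ≤ i := by exact_mod_cast hk.2
      have : 0 ≤ (i : ℝ) - k + 1 := by linarith
      have := hq i k
      exact mul_nonneg (by positivity) hP
    have hs : ∑ k ∈ Icc 1 i, T k ≤ Q * i * (A * ((j : ℝ) * (h i + h j)) * (x i * x j)) := by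
      rw [hT, ← Finset.sum_mul]
      refine mul_le_mul_of_nonneg_right ?_ hP
      rcases Nat.eq_zero_or_pos i with rfl | hi
      · simp
      · exact hqs i hi
    calc ∑ k ∈ range (n + 1), wE a x (i, j, k) * Θ (i, j, k)
        ≤ ∑ k ∈ range (n + 1), if k ∈ Icc 1 i then T k else 0 := by
          refine Finset.sum_le_sum fun k _ => ?_
          unfold wE
          simp only [mem_Icc]
          split_ifs with hk
          · have := mul_le_mul_of_nonneg_right (hΘ i j k hk.1 hk.2) (mul_nonneg (hx i) (hx j))
            simp only [hT]
            linarith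
          · simp
      _ = ∑ k ∈ (range (n + 1)).filter (· ∈ Icc 1 i), T k := by rw [Finset.sum_filter]
      _ ≤ ∑ k ∈ Icc 1 i, T k := by
          refine Finset.sum_le_sum_of_subset_of_nonneg ?_ (fun k hk _ => hT0 k hk)
          intro k hk
          exact (Finset.mem_filter.1 hk).2
      _ ≤ _ := hs
      _ = _ := by ring
  have hM0 : 0 ≤ M := hM.nonneg fun i => mul_nonneg (by positivity) (hx i)
  have hHn : ∀ i : ℕ, 0 ≤ (i : ℝ) * h i * x i := fun i => by
    have := h1 i; have := hx i
    have : 0 ≤ h i := by linarith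
    positivity
  have hS1 : ∑ i ∈ range (n + 1), (i : ℝ) * x i ≤ M := by
    refine le_trans (Finset.sum_le_sum fun i _ => ?_) (sum_le_of_hasSum_nonneg
      (fun i => mul_nonneg (by positivity) (hx i)) hM (range (n + 1)))
    nlinarith [hx i]
  have hS1n : 0 ≤ ∑ i ∈ range (n + 1), (i : ℝ) * x i :=
    Finset.sum_nonneg fun i _ => mul_nonneg (by positivity) (hx i)
  have hS2 : ∑ i ∈ range (n + 1), (i : ℝ) * h i * x i ≤ H := sum_le_of_hasSum_nonneg hHn hH _
  have hS2n : 0 ≤ ∑ i ∈ range (n + 1), (i : ℝ) * h i * x i :=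
    Finset.sum_nonneg fun i _ => hHn i
  have hH0 : 0 ≤ H := hS2n.trans hS2
  unfold ebox
  rw [Finset.sum_product]
  simp_rw [Finset.sum_product]
  calc _ ≤ ∑ i ∈ range (n + 1), ∑ j ∈ range (n + 1),
        A * Q * ((i : ℝ) * x i * ((j : ℝ) * x j) * (h i + h j)) :=
        Finset.sum_le_sum fun i _ => Finset.sum_le_sum fun j _ => hin i j
    _ = A * Q * ((∑ i ∈ range (n + 1), (i : ℝ) * h i * x i) * (∑ i ∈ range (n + 1), (i : ℝ) * x i)
          + (∑ i ∈ range (n + 1), (i : ℝ) * x i) * (∑ i ∈ range (n + 1), (i : ℝ) * h i * x i)) := by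
        rw [Finset.sum_mul_sum, Finset.sum_mul_sum, ← Finset.sum_add_distrib, Finset.mul_sum]
        refine Finset.sum_congr rfl fun i _ => ?_
        rw [← Finset.sum_add_distrib, Finset.mul_sum]
        refine Finset.sum_congr rfl fun j _ => ?_
        ring
    _ ≤ A * Q * (H * M + M * H) := by gcongr
    _ = _ := by ring

/-- sublinear growth weights -/
structure GoodW (h : ℕ → ℝ) : Prop where
  one : ∀ n, 1 ≤ h n
  mono : Monotone h
  slow : ∀ x y : ℕ, (y : ℝ) * h (x + y) ≤ ((x : ℝ) + y) * h y

lemma GoodW.double {h : ℕ → ℝ} (hh : GoodW h) {x y : ℕ} (hxy : x ≤ y) (hy : 1 ≤ y) :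
    h (x + y) ≤ 2 * h y := by
  have h1 := hh.slow x y
  have hy' : (0:ℝ) < y := by exact_mod_cast hy
  have hx' : (x:ℝ) ≤ y := by exact_mod_cast hxy
  have h2 := hh.one y
  have : (y:ℝ) * h (x + y) ≤ y * (2 * h y) := by nlinarith
  exact le_of_mul_le_mul_left this hy'

lemma GoodW.defect_aux {h : ℕ → ℝ} (hh : GoodW h) {x y : ℕ} (hxy : x ≤ y) (hy : 1 ≤ y) :
    ((x : ℝ) + y) * (((x:ℝ) + y) * h (x + y) - x * h x - y * h y) ≤ 6 * (x * y * h y) := by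
  have hd := hh.double hxy hy
  have hs := hh.slow x y
  have hx0 : (0:ℝ) ≤ x := by positivity
  have hy0 : (0:ℝ) ≤ y := by positivity
  have hx' : (x:ℝ) ≤ y := by exact_mod_cast hxy
  have h2 := hh.one y
  have h3 := hh.one x
  have hD : ((x:ℝ) + y) * h (x + y) - x * h x - y * h y ≤ 3 * (x * h y) := by
    have e1 : (x:ℝ) * h (x + y) ≤ x * (2 * h y) := by gcongr
    have e2 : 0 ≤ (x:ℝ) * h x := by have : 0 ≤ h x := by linarith
                                    positivity
    nlinarith
  calc ((x : ℝ) + y) * (((x:ℝ) + y) * h (x + y) - x * h x - y * h y)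
      ≤ ((x : ℝ) + y) * (3 * (x * h y)) := by gcongr
    _ ≤ (y + y) * (3 * (x * h y)) := by
        have : 0 ≤ h y := by linarith
        gcongr
    _ = _ := by ring

lemma GoodW.defect {h : ℕ → ℝ} (hh : GoodW h) {j k i : ℕ} (hj : 1 ≤ j) (hk : 1 ≤ k) (hki : k ≤ i) :
    ((j : ℝ) + k) * (((j:ℝ) + k) * h (j + k) - j * h j - k * h k) ≤ 6 * (j * k * (h i + h j)) := by
  have h1 := hh.one i
  have h2 := hh.one j
  have h3 := hh.mono hki
  have hjk : 0 ≤ (j : ℝ) * k := by positivity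
  rcases le_total j k with hjk' | hjk'
  · have := hh.defect_aux hjk' hk
    have h4 : (j : ℝ) * k * h k ≤ j * k * (h i + h j) := mul_le_mul_of_nonneg_left (by linarith) hjk
    linarith
  · have := hh.defect_aux hjk' hj
    rw [add_comm k j] at this
    have h4 : (j : ℝ) * k * h j ≤ j * k * (h i + h j) := mul_le_mul_of_nonneg_left (by linarith) hjk
    nlinarith

lemma GoodW.super {h : ℕ → ℝ} (hh : GoodW h) {k i : ℕ} (hki : k ≤ i) :
    ((i - k : ℕ) : ℝ) * h (i - k) + k * h k ≤ i * h i := by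
  have h1 := hh.mono (Nat.sub_le i k)
  have h2 := hh.mono hki
  have e : (i : ℝ) = ((i - k : ℕ) : ℝ) + k := by rw [Nat.cast_sub hki]; ring
  calc _ ≤ ((i - k : ℕ) : ℝ) * h i + k * h i := by gcongr
    _ = i * h i := by rw [← add_mul, ← e]

lemma theta_phi {a : ℕ → ℕ → ℕ → ℝ} (ha : ∀ i j k, 0 ≤ a i j k) {C Q : ℝ} {q : ℕ → ℕ → ℝ}
    (hGB : GB a C Q q) {h : ℕ → ℝ} (hh : GoodW h) (i j k : ℕ) (hk : 1 ≤ k) (hki : k ≤ i) :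
    a i j k * sg (fun m => (m : ℝ) * h m) (i, j, k) ≤
      (6 * C) * ((k : ℝ) * ((i : ℝ) - k + 1) * q i k) * ((j : ℝ) * (h i + h j)) := by
  obtain ⟨hC, hQ, hq, hqs, hab⟩ := hGB
  have hsup := hh.super hki
  simp only [sg]
  rcases Nat.eq_zero_or_pos j with rfl | hj
  · simp only [zero_add, Nat.cast_zero, zero_mul, mul_zero]
    refine mul_nonpos_of_nonneg_of_nonpos (ha _ _ _) ?_
    linarith
  · have hd := hh.defect hj hk hki
    have hab' := hab i j k hk hki hj
    have hik : (k : ℝ) ≤ i := by exact_mod_cast hki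
    have hc : 0 ≤ C * ((i : ℝ) - k + 1) * q i k :=
      mul_nonneg (mul_nonneg (by linarith) (by linarith)) (hq i k)
    set D : ℝ := ((j:ℝ) + k) * h (j + k) - j * h j - k * h k with hD
    have hD0 : 0 ≤ D := by
      have := hh.super (Nat.le_add_left k j)
      simp only [Nat.add_sub_cancel] at this
      push_cast at this
      linarith
    calc _ ≤ a i j k * D := by
          refine mul_le_mul_of_nonneg_left ?_ (ha _ _ _)
          push_cast
          linarith
      _ ≤ (C * ((i : ℝ) - k + 1) * ((j : ℝ) + k) * q i k) * D :=
          mul_le_mul_of_nonneg_right hab' hD0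
      _ = (C * ((i : ℝ) - k + 1) * q i k) * (((j : ℝ) + k) * D) := by ring
      _ ≤ (C * ((i : ℝ) - k + 1) * q i k) * (6 * (j * k * (h i + h j))) :=
          mul_le_mul_of_nonneg_left hd hc
      _ = _ := by ring

lemma theta_tail {a : ℕ → ℕ → ℕ → ℝ} (ha : ∀ i j k, 0 ≤ a i j k)
    (hzero : ∀ p : ℕ, 1 ≤ p → a p 0 p = 0) {C Q : ℝ} {q : ℕ → ℕ → ℝ}
    (hGB : GB a C Q q) {h : ℕ → ℝ} (hh : GoodW h) {J : ℕ} (hJ : 1 ≤ J)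
    (i j k : ℕ) (hk : 1 ≤ k) (hki : k ≤ i) :
    a i j k * ((if (i, j, k) ∈ ebox J then 0 else 1) +
        sg (fun m => ((m - J : ℕ) : ℝ)) (i, j, k)) ≤
      (6 * C / h J) * ((k : ℝ) * ((i : ℝ) - k + 1) * q i k) * ((j : ℝ) * (h i + h j)) := by
  obtain ⟨hC, hQ, hq, hqs, hab⟩ := hGB
  simp only [sg, mem_ebox]
  rcases Nat.eq_zero_or_pos j with rfl | hj
  · simp only [Nat.cast_zero, zero_mul, mul_zero]
    rcases hki.eq_or_lt with rfl | hlt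
    · rw [hzero k hk]; simp
    refine mul_nonpos_of_nonneg_of_nonpos (ha _ _ _) ?_
    split_ifs with hb
    · have : ((i - k - J : ℕ) : ℝ) + ((0 + k - J : ℕ) : ℝ) ≤ ((i - J : ℕ) : ℝ) + ((0 - J : ℕ) : ℝ) := by
        norm_cast
        omega
      linarith
    · have : 1 + ((i - k - J : ℕ) : ℝ) + ((0 + k - J : ℕ) : ℝ) ≤
          ((i - J : ℕ) : ℝ) + ((0 - J : ℕ) : ℝ) := by
        norm_cast
        omega
      linarith
  · have hab' := hab i j k hk hki hj
    have hik : (k : ℝ) ≤ i := by exact_mod_cast hki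
    have hc : 0 ≤ C * ((i : ℝ) - k + 1) * q i k :=
      mul_nonneg (mul_nonneg (by linarith) (by linarith)) (hq i k)
    have hJ1 := hh.one J
    have hi1 := hh.one i
    have hj1 := hh.one j
    have hJp : 0 < h J := by linarith
    have hjr : (1:ℝ) ≤ j := by exact_mod_cast hj
    have hkr : (1:ℝ) ≤ k := by exact_mod_cast hk
    have hjk2 : (j:ℝ) + k ≤ 2 * (j * k) := by nlinarith
    -- the natural number defect
    obtain ⟨D, hD⟩ : ∃ D : ℕ, D = (j + k - J) - (j - J) - (k - J) := ⟨_, rfl⟩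
    have hDj : D ≤ j := by omega
    have hDk : D ≤ k := by omega
    have hDle : ((i - k - J : ℕ) : ℝ) + ((j + k - J : ℕ) : ℝ) - ((i - J : ℕ) : ℝ)
        - ((j - J : ℕ) : ℝ) ≤ D := by
      have : (i - k - J) + (j + k - J) ≤ D + (i - J) + (j - J) := by omega
      have : (((i - k - J : ℕ) : ℝ) + ((j + k - J : ℕ) : ℝ)) ≤
        D + ((i - J : ℕ) : ℝ) + ((j - J : ℕ) : ℝ) := by exact_mod_cast this
      linarith
    have hDd : ((j : ℝ) + k) * D * h J ≤ 4 * (j * k * (h i + h j)) := by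
      rcases Nat.eq_zero_or_pos D with h0 | hDp
      · rw [h0]
        simp only [Nat.cast_zero, mul_zero, zero_mul]
        have : 0 ≤ h i + h j := by linarith
        positivity
      · have hJjk : J ≤ j + k := by omega
        have e1 : h J ≤ 2 * (h i + h j) := by
          refine (hh.mono hJjk).trans ?_
          have hki' := hh.mono hki
          rcases le_total j k with hle | hle
          · have := hh.double hle hk
            linarith
          · have := hh.double hle hj
            rw [add_comm k j] at this
            linarith
        have e2 : ((j : ℝ) + k) * D ≤ 2 * (j * k) := by
          have d1 : (D : ℝ) ≤ j := by exact_mod_cast hDj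
          have d2 : (D : ℝ) ≤ k := by exact_mod_cast hDk
          nlinarith
        calc ((j : ℝ) + k) * D * h J ≤ 2 * (j * k) * (2 * (h i + h j)) := by gcongr
          _ = _ := by ring
    set I : ℝ := if i ≤ J ∧ j ≤ J ∧ k ≤ J then 0 else 1 with hI
    have hI0 : 0 ≤ I := by rw [hI]; split_ifs <;> norm_num
    have hIh : I * h J ≤ h i + h j := by
      rw [hI]
      split_ifs with hb
      · linarith
      · have : J ≤ i ∨ J ≤ j := by omega
        rcases this with hb | hb
        · have := hh.mono hb; linarith
        · have := hh.mono hb; linarith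
    have hfin : ((j : ℝ) + k) * (I + D) ≤ 6 / h J * (j * k * (h i + h j)) := by
      rw [div_mul_eq_mul_div, le_div_iff₀ hJp]
      have : ((j:ℝ) + k) * (I * h J) ≤ 2 * (j * k) * (h i + h j) := by gcongr
      linarith
    have hID : 0 ≤ I + D := by positivity
    calc _ ≤ a i j k * (I + D) := by
          refine mul_le_mul_of_nonneg_left ?_ (ha _ _ _)
          linarith
      _ ≤ (C * ((i : ℝ) - k + 1) * ((j : ℝ) + k) * q i k) * (I + D) :=
          mul_le_mul_of_nonneg_right hab' hID
      _ = (C * ((i : ℝ) - k + 1) * q i k) * (((j : ℝ) + k) * (I + D)) := by ring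
      _ ≤ (C * ((i : ℝ) - k + 1) * q i k) * (6 / h J * (j * k * (h i + h j))) :=
          mul_le_mul_of_nonneg_left hfin hc
      _ = _ := by ring

open Finset MeasureTheory

/-- indicator of the point `m` -/
noncomputable def dl (m : ℕ) : ℕ → ℝ := fun r => if r = m then 1 else 0

/-- one explicit Euler step of the system restricted to the events in `ebox n` -/
noncomputable def estep (a : ℕ → ℕ → ℕ → ℝ) (n : ℕ) (τ : ℝ) (x : ℕ → ℝ) : ℕ → ℝ :=
  fun m => x m + τ * ∑ e ∈ ebox n, wE a x e * sg (dl m) e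

/-- Euler scheme -/
noncomputable def eul (a : ℕ → ℕ → ℕ → ℝ) (n : ℕ) (τ : ℝ) (c0 : ℕ → ℝ) : ℕ → ℕ → ℝ
  | 0 => c0
  | l + 1 => estep a n τ (eul a n τ c0 l)

lemma hasSum_dl (g : ℕ → ℝ) (r : ℕ) : HasSum (fun m => g m * dl m r) (g r) := by
  have : (fun m => g m * dl m r) = fun m => if m = r then g r else 0 := by
    funext m
    unfold dl
    by_cases hm : m = r
    · subst hm; simp
    · simp [hm, Ne.symm hm]
  rw [this]
  exact hasSum_ite_eq r (g r)

lemma hasSum_sg (g : ℕ → ℝ) (e : ℕ × ℕ × ℕ) : HasSum (fun m => g m * sg (dl m) e) (sg g e) := by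
  have := (((hasSum_dl g (e.1 - e.2.2)).add (hasSum_dl g (e.2.1 + e.2.2))).sub
    (hasSum_dl g e.1)).sub (hasSum_dl g e.2.1)
  refine HasSum.congr_fun this (fun m => ?_)
  unfold sg
  ring

lemma estep_hasSum (a : ℕ → ℕ → ℕ → ℝ) (n : ℕ) (τ : ℝ) (x : ℕ → ℝ) (g : ℕ → ℝ) {s : ℝ}
    (hs : HasSum (fun m => g m * x m) s) :
    HasSum (fun m => g m * estep a n τ x m) (s + τ * ∑ e ∈ ebox n, wE a x e * sg g e) := by
  have h1 : HasSum (fun m => ∑ e ∈ ebox n, wE a x e * (g m * sg (dl m) e))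
      (∑ e ∈ ebox n, wE a x e * sg g e) :=
    hasSum_sum fun e _ => (hasSum_sg g e).mul_left _
  have h2 := hs.add (h1.mul_left τ)
  convert h2 using 2 with m
  unfold estep
  rw [mul_add, Finset.mul_sum, Finset.mul_sum, Finset.mul_sum]
  congr 1
  refine Finset.sum_congr rfl fun e _ => ?_
  ring

lemma estep_nonneg {a : ℕ → ℕ → ℕ → ℝ} (ha : ∀ i j k, 0 ≤ a i j k) {n : ℕ} {τ : ℝ} (hτ : 0 ≤ τ)
    {x : ℕ → ℝ} (hx : ∀ i, 0 ≤ x i) {M : ℝ} (hM : ∀ i, x i ≤ M)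
    (hsm : τ * (2 * M * ∑ e ∈ ebox n, a e.1 e.2.1 e.2.2) ≤ 1) (m : ℕ) :
    0 ≤ estep a n τ x m := by
  have hM0 : 0 ≤ M := (hx 0).trans (hM 0)
  have hkey : -(x m * (2 * M * ∑ e ∈ ebox n, a e.1 e.2.1 e.2.2)) ≤
      ∑ e ∈ ebox n, wE a x e * sg (dl m) e := by
    rw [Finset.mul_sum, Finset.mul_sum, ← Finset.sum_neg_distrib]
    refine Finset.sum_le_sum fun e _ => ?_
    obtain ⟨i, j, k⟩ := e
    have hw := wE_nonneg ha hx (i, j, k)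
    have hwle : wE a x (i, j, k) ≤ a i j k * x i * x j := by
      unfold wE
      split_ifs
      · exact le_rfl
      · exact mul_nonneg (mul_nonneg (ha _ _ _) (hx _)) (hx _)
    have haM : 0 ≤ a i j k * M * x m := mul_nonneg (mul_nonneg (ha _ _ _) hM0) (hx m)
    have d0 : ∀ r, 0 ≤ dl m r := fun r => by unfold dl; split_ifs <;> norm_num
    have e1 : wE a x (i, j, k) * dl m i ≤ a i j k * M * x m := by
      unfold dl
      split_ifs with hi
      · subst hi
        have : a i j k * x i * x j ≤ a i j k * x i * M :=
          mul_le_mul_of_nonneg_left (hM j) (mul_nonneg (ha _ _ _) (hx _))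
        linarith
      · simpa using haM
    have e2 : wE a x (i, j, k) * dl m j ≤ a i j k * M * x m := by
      unfold dl
      split_ifs with hi
      · subst hi
        have : a i j k * x i * x j ≤ a i j k * M * x j :=
          mul_le_mul_of_nonneg_right (mul_le_mul_of_nonneg_left (hM i) (ha _ _ _)) (hx _)
        linarith
      · simpa using haM
    have e3 := mul_nonneg hw (d0 (i - k))
    have e4 := mul_nonneg hw (d0 (j + k))
    simp only [sg]
    linarith
  unfold estep
  have h1 := mul_le_mul_of_nonneg_left hkey hτ
  have h2 := mul_le_mul_of_nonneg_left hsm (hx m)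
  linarith

section scheme
variable {a : ℕ → ℕ → ℕ → ℝ} {C Q : ℝ} {q : ℕ → ℕ → ℝ} {h : ℕ → ℝ} {c0 : ℕ → ℝ} {M H0 : ℝ}
  {n : ℕ} {τ : ℝ}

lemma le_of_hasSum_mass {x : ℕ → ℝ} (hx : ∀ i, 0 ≤ x i)
    (hM : HasSum (fun i : ℕ => (1 + (i : ℝ)) * x i) M) (i : ℕ) : x i ≤ M := by
  have h1 := le_hasSum hM i (fun j _ => mul_nonneg (by positivity) (hx j))
  have h2 : 0 ≤ (i : ℝ) * x i := mul_nonneg (by positivity) (hx i)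
  linarith

lemma eul_inv (ha : ∀ i j k, 0 ≤ a i j k) (hGB : GB a C Q q) (hh : GoodW h)
    (hc0 : ∀ i, 0 ≤ c0 i) (hM : HasSum (fun i : ℕ => (1 + (i : ℝ)) * c0 i) M)
    (hH : HasSum (fun i : ℕ => (i : ℝ) * h i * c0 i) H0) (hτ : 0 ≤ τ)
    (hsm : τ * (2 * M * ∑ e ∈ ebox n, a e.1 e.2.1 e.2.2) ≤ 1) (l : ℕ) :
    (∀ i, 0 ≤ eul a n τ c0 l i) ∧
    HasSum (fun i : ℕ => (1 + (i : ℝ)) * eul a n τ c0 l i) M ∧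
    ∃ H, HasSum (fun i : ℕ => (i : ℝ) * h i * eul a n τ c0 l i) H ∧
      H ≤ H0 * Real.exp ((12 * C * Q * M) * (τ * l)) := by
  have hM0 : 0 ≤ M := hM.nonneg fun i => mul_nonneg (by positivity) (hc0 i)
  have hC := hGB.1
  have hQ := hGB.2.1
  induction l with
  | zero => exact ⟨hc0, hM, H0, hH, by simp⟩
  | succ l ih =>
    obtain ⟨hx, hMx, H, hHx, hHle⟩ := ih
    refine ⟨?_, ?_, ?_⟩
    · exact estep_nonneg ha hτ hx (le_of_hasSum_mass hx hMx) hsm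
    · have := estep_hasSum a n τ _ _ hMx
      have h0 : ∑ e ∈ ebox n, wE a (eul a n τ c0 l) e * sg (fun i : ℕ => (1 + (i : ℝ))) e = 0 := by
        refine Finset.sum_eq_zero fun e _ => ?_
        unfold wE sg
        split_ifs with hk
        · simp only [Nat.cast_sub hk.2]
          push_cast
          ring
        · simp
      rw [h0, mul_zero, add_zero] at this
      exact this
    · refine ⟨_, estep_hasSum a n τ _ _ hHx, ?_⟩
      have hk := key_sum hGB hh.one (by positivity : (0:ℝ) ≤ 6 * C) _
        (theta_phi ha hGB hh) hx hMx hHx n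
      have hH0 : 0 ≤ H := hHx.nonneg fun i => by
        have := hh.one i
        exact mul_nonneg (mul_nonneg (by positivity) (by linarith)) (hx i)
      set K := 12 * C * Q * M with hK
      have e1 : H + τ * ∑ e ∈ ebox n, wE a (eul a n τ c0 l) e * sg (fun m => (m : ℝ) * h m) e
          ≤ H * (1 + K * τ) := by
        have := mul_le_mul_of_nonneg_left hk hτ
        rw [hK]
        linarith
      refine e1.trans ?_
      have e2 : 1 + K * τ ≤ Real.exp (K * τ) := by
        have := Real.add_one_le_exp (K * τ)
        linarith
      calc H * (1 + K * τ) ≤ H * Real.exp (K * τ) := by gcongr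
        _ ≤ (H0 * Real.exp (K * (τ * l))) * Real.exp (K * τ) := by gcongr
        _ = _ := by
          rw [mul_assoc, ← Real.exp_add]
          push_cast
          ring_nf

lemma eul_tail (ha : ∀ i j k, 0 ≤ a i j k) (hzero : ∀ p : ℕ, 1 ≤ p → a p 0 p = 0)
    (hGB : GB a C Q q) (hh : GoodW h)
    (hc0 : ∀ i, 0 ≤ c0 i) (hM : HasSum (fun i : ℕ => (1 + (i : ℝ)) * c0 i) M)
    (hH : HasSum (fun i : ℕ => (i : ℝ) * h i * c0 i) H0) (hτ : 0 ≤ τ)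
    (hsm : τ * (2 * M * ∑ e ∈ ebox n, a e.1 e.2.1 e.2.2) ≤ 1) {J : ℕ} (hJ : 1 ≤ J) {t : ℝ}
    (L : ℕ) (hL : τ * L ≤ t) :
    τ * ∑ l ∈ range L, ∑ e ∈ ebox n, wE a (eul a n τ c0 l) e * (if e ∈ ebox J then 0 else 1) ≤
      H0 * (1 + (12 * C * Q * M) * t * Real.exp ((12 * C * Q * M) * t)) / h J := by
  have hM0 : 0 ≤ M := hM.nonneg fun i => mul_nonneg (by positivity) (hc0 i)
  have hC := hGB.1
  have hQ := hGB.2.1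
  have hJp : 0 < h J := by have := hh.one J; linarith
  have hH00 : 0 ≤ H0 := hH.nonneg fun i => by
    have := hh.one i
    exact mul_nonneg (mul_nonneg (by positivity) (by linarith)) (hc0 i)
  set K := 12 * C * Q * M with hK
  have hK0 : 0 ≤ K := by positivity
  have ht0 : 0 ≤ t := le_trans (by positivity) hL
  set E := H0 * Real.exp (K * t) with hE
  have hE0 : 0 ≤ E := by positivity
  have hsumm : ∀ l, Summable (fun i : ℕ => ((i - J : ℕ) : ℝ) * eul a n τ c0 l i) := by
    intro l
    obtain ⟨hx, hMx, -⟩ := eul_inv ha hGB hh hc0 hM hH hτ hsm l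
    refine Summable.of_nonneg_of_le (fun i => mul_nonneg (by positivity) (hx i)) (fun i => ?_)
      hMx.summable
    refine mul_le_mul_of_nonneg_right ?_ (hx i)
    have : ((i - J : ℕ) : ℝ) ≤ i := by exact_mod_cast Nat.sub_le i J
    linarith
  have hind : ∀ l : ℕ, l ≤ L → (∑' i : ℕ, ((i - J : ℕ) : ℝ) * eul a n τ c0 l i) +
      τ * ∑ l' ∈ range l, ∑ e ∈ ebox n, wE a (eul a n τ c0 l') e * (if e ∈ ebox J then 0 else 1) ≤
      H0 / h J + τ * l * (K * E / h J) := by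
    intro l
    induction l with
    | zero =>
      intro _
      have h1 : ∑' i : ℕ, ((i - J : ℕ) : ℝ) * c0 i ≤ ∑' i : ℕ, ((i : ℝ) * h i * c0 i) / h J := by
        refine Summable.tsum_le_tsum (fun i => ?_) (hsumm 0) (hH.summable.div_const _)
        rw [le_div_iff₀ hJp]
        rcases le_total i J with hi | hi
        · rw [Nat.sub_eq_zero_of_le hi]
          have := hh.one i
          simpa using mul_nonneg (mul_nonneg (by positivity) (by linarith)) (hc0 i)
        · have e1 : ((i - J : ℕ) : ℝ) ≤ i := by exact_mod_cast Nat.sub_le i J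
          have e2 := hh.mono hi
          have e3 := hc0 i
          calc ((i - J : ℕ) : ℝ) * c0 i * h J = ((i - J : ℕ) : ℝ) * h J * c0 i := by ring
            _ ≤ _ := by gcongr
      rw [tsum_div_const, hH.tsum_eq] at h1
      simpa [eul] using h1
    | succ l ih =>
      intro hlL
      have ih' := ih (by omega)
      obtain ⟨hx, hMx, H, hHx, hHle⟩ := eul_inv ha hGB hh hc0 hM hH hτ hsm l
      have hst := estep_hasSum a n τ _ _ (hsumm l).hasSum
      have hk := key_sum hGB hh.one (by positivity : (0:ℝ) ≤ 6 * C / h J)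
        (fun e => (if e ∈ ebox J then 0 else 1) + sg (fun m => ((m - J : ℕ) : ℝ)) e)
        (fun i j k hk hki => theta_tail ha hzero hGB hh hJ i j k hk hki) hx hMx hHx n
      have hHE : H ≤ E := by
        refine hHle.trans ?_
        have : τ * l ≤ t := le_trans (by
          have : (l : ℝ) ≤ L := by exact_mod_cast (by omega : l ≤ L)
          gcongr) hL
        rw [hE]
        gcongr
      have hk2 : 2 * (6 * C / h J) * Q * M * H ≤ K * E / h J := by
        have : 2 * (6 * C / h J) * Q * M * H = K * H / h J := by rw [hK]; ring
        rw [this]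
        gcongr
      simp only [mul_add, Finset.sum_add_distrib] at hk
      have hts : ∑' i : ℕ, ((i - J : ℕ) : ℝ) * eul a n τ c0 (l + 1) i = _ := hst.tsum_eq
      rw [hts, Finset.sum_range_succ]
      have hk3 := mul_le_mul_of_nonneg_left (hk.trans hk2) hτ
      push_cast
      linarith
  have hfin := hind L le_rfl
  have hR : 0 ≤ ∑' i : ℕ, ((i - J : ℕ) : ℝ) * eul a n τ c0 L i :=
    tsum_nonneg fun i => mul_nonneg (by positivity)
      ((eul_inv ha hGB hh hc0 hM hH hτ hsm L).1 i)
  have hlast : τ * L * (K * E / h J) ≤ t * (K * E / h J) := by gcongr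
  have : H0 * (1 + K * t * Real.exp (K * t)) / h J = H0 / h J + t * (K * E / h J) := by
    rw [hE]; ring
  rw [this]
  linarith

end scheme

open Finset MeasureTheory Filter Topology

/-- The properties of the Euler approximations used in the limit. -/
structure Approx (a : ℕ → ℕ → ℕ → ℝ) (c0 : ℕ → ℝ) (M : ℝ) (B : ℝ → ℝ) (h : ℕ → ℝ)
    (τ : ℕ → ℝ) (X : ℕ → ℕ → ℕ → ℝ) : Prop where
  ha : ∀ i j k, 0 ≤ a i j k
  τpos : ∀ n, 0 < τ n
  τlim : Tendsto τ atTop (𝓝 0)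
  atZero : ∀ n, X n 0 = c0
  nonneg : ∀ n l i, 0 ≤ X n l i
  mass : ∀ n l (S : Finset ℕ), ∑ i ∈ S, (1 + (i : ℝ)) * X n l i ≤ M
  rep : ∀ n L m, X n L m = c0 m +
    ∑ e ∈ ebox n, (τ n * ∑ l ∈ range L, wE a (X n l) e) * sg (dl m) e
  h1 : ∀ n, 1 ≤ h n
  hlim : Tendsto h atTop atTop
  Bmono : ∀ s t, 0 ≤ s → s ≤ t → B s ≤ B t
  tail : ∀ (n J L : ℕ) (t : ℝ), 1 ≤ J → τ n * L ≤ t →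
    τ n * ∑ l ∈ range L, ∑ e ∈ ebox n, wE a (X n l) e * (if e ∈ ebox J then 0 else 1) ≤ B t / h J

lemma approx_exists (a : ℕ → ℕ → ℕ → ℝ) (ha : ∀ i j k, 0 ≤ a i j k)
    (hzero : ∀ p : ℕ, 1 ≤ p → a p 0 p = 0)
    (C Q : ℝ) (q : ℕ → ℕ → ℝ) (hGB : GB a C Q q)
    (c0 : ℕ → ℝ) (hc0 : ∀ i, 0 ≤ c0 i)
    (hX : Summable (fun i : ℕ => (1 + (i : ℝ)) * c0 i)) :
    ∃ M B h τ X, Approx a c0 M B h τ X := by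
  obtain ⟨h, h1, hmono, hslow, hlim, hsum⟩ := exists_weight c0 hc0 hX
  have hh : GoodW h := ⟨h1, hmono, hslow⟩
  obtain ⟨M, hM⟩ := hX
  obtain ⟨H0, hH⟩ := hsum
  have hM0 : 0 ≤ M := hM.nonneg fun i => mul_nonneg (by positivity) (hc0 i)
  have hC := hGB.1
  have hQ := hGB.2.1
  have hH00 : 0 ≤ H0 := hH.nonneg fun i => by
    have := hh.one i
    exact mul_nonneg (mul_nonneg (by positivity) (by linarith)) (hc0 i)
  set P : ℕ → ℝ := fun n => 2 * M * ∑ e ∈ ebox n, a e.1 e.2.1 e.2.2 with hP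
  have hP0 : ∀ n, 0 ≤ P n := fun n =>
    mul_nonneg (by positivity) (Finset.sum_nonneg fun e _ => ha _ _ _)
  set τ : ℕ → ℝ := fun n => 1 / ((n : ℝ) + 1 + P n) with hτ
  have hτp : ∀ n, 0 < τ n := fun n => by
    have := hP0 n
    simp only [hτ]
    positivity
  have hsm : ∀ n, τ n * P n ≤ 1 := fun n => by
    have := hP0 n
    simp only [hτ]
    rw [one_div_mul_eq_div, div_le_one (by positivity)]
    have : (0:ℝ) ≤ n := by positivity
    linarith
  refine ⟨M, fun t => H0 * (1 + (12 * C * Q * M) * t * Real.exp ((12 * C * Q * M) * t)), h, τ,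
    fun n => eul a n (τ n) c0, ?_⟩
  refine ⟨ha, hτp, ?_, fun n => rfl, fun n l => (eul_inv ha hGB hh hc0 hM hH (hτp n).le (hsm n) l).1,
    ?_, ?_, h1, hlim, ?_, ?_⟩
  · refine squeeze_zero (fun n => (hτp n).le) (fun n => ?_) tendsto_one_div_add_atTop_nhds_zero_nat
    have := hP0 n
    simp only [hτ]
    refine one_div_le_one_div_of_le (by positivity) ?_
    linarith
  · intro n l S
    obtain ⟨hx, hMx, -⟩ := eul_inv ha hGB hh hc0 hM hH (hτp n).le (hsm n) l
    exact sum_le_of_hasSum_nonneg (fun i => mul_nonneg (by positivity) (hx i)) hMx S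
  · intro n L m
    induction L with
    | zero => simp [eul]
    | succ L ih =>
      simp only [eul, estep, Finset.sum_range_succ, mul_add, add_mul, Finset.sum_add_distrib]
      rw [ih, add_assoc, Finset.mul_sum]
      simp only [mul_assoc]
  · intro s t hs hst
    have ht : 0 ≤ t := hs.trans hst
    have hK0 : 0 ≤ 12 * C * Q * M := by positivity
    gcongr
  · intro n J L t hJ hL
    exact eul_tail ha hzero hGB hh hc0 hM hH (hτp n).le (hsm n) hJ L hL

lemma step_meas (G : ℕ → ℝ) (τ : ℝ) : Measurable (fun s : ℝ => G ⌊s / τ⌋₊) := by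
  have h1 : Measurable (fun s : ℝ => ⌊s / τ⌋₊) := Nat.measurable_floor.comp (measurable_id.div_const τ)
  exact (measurable_from_top (f := G)).comp h1

lemma step_intervalIntegrable (G : ℕ → ℝ) {τ K : ℝ} (hG : ∀ l, |G l| ≤ K) (s t : ℝ) :
    IntervalIntegrable (fun s : ℝ => G ⌊s / τ⌋₊) volume s t := by
  refine (intervalIntegrable_const (c := K)).mono_fun (step_meas G τ).aestronglyMeasurable ?_
  refine Eventually.of_forall fun s => ?_
  simp only [Real.norm_eq_abs]
  exact (hG _).trans (le_abs_self K)

lemma step_integral (G : ℕ → ℝ) {τ K : ℝ} (hτ : 0 < τ) (hG : ∀ l, |G l| ≤ K) (L : ℕ) :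
    ∫ s in (0:ℝ)..(τ * L), G ⌊s / τ⌋₊ = τ * ∑ l ∈ range L, G l := by
  induction L with
  | zero => simp
  | succ L ih =>
    rw [← intervalIntegral.integral_add_adjacent_intervals
      (step_intervalIntegrable G hG 0 (τ * L)) (step_intervalIntegrable G hG (τ * L) _), ih,
      Finset.sum_range_succ, mul_add]
    congr 1
    rw [intervalIntegral.integral_congr_Ioo_of_le (g := fun _ => G L)]
    · simp
      left
      ring
    · push_cast
      nlinarith
    · intro s hs
      have : ⌊s / τ⌋₊ = L := by
        rw [Nat.floor_eq_iff (div_nonneg (le_trans (by positivity) hs.1.le) hτ.le)]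
        have h2 := hs.2
        push_cast at h2
        constructor
        · rw [le_div_iff₀ hτ]; linarith [hs.1]
        · rw [div_lt_iff₀ hτ]; linarith
      simp only [this]

lemma sg_dl_abs (m : ℕ) (e : ℕ × ℕ × ℕ) : |sg (dl m) e| ≤ 2 := by
  have d0 : ∀ r, 0 ≤ dl m r ∧ dl m r ≤ 1 := fun r => by unfold dl; split_ifs <;> norm_num
  unfold sg
  have h1 := d0 (e.1 - e.2.2)
  have h2 := d0 (e.2.1 + e.2.2)
  have h3 := d0 e.1
  have h4 := d0 e.2.1
  rw [abs_le]
  constructor <;> linarith [h1.1, h1.2, h2.1, h2.2, h3.1, h3.2, h4.1, h4.2]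

lemma wE_le {a : ℕ → ℕ → ℕ → ℝ} (ha : ∀ i j k, 0 ≤ a i j k) {x : ℕ → ℝ} {M : ℝ}
    (hx : ∀ i, 0 ≤ x i) (hM : ∀ i, x i ≤ M)
    (e : ℕ × ℕ × ℕ) : wE a x e ≤ a e.1 e.2.1 e.2.2 * M ^ 2 := by
  have hM0 : 0 ≤ M := (hx 0).trans (hM 0)
  have := ha e.1 e.2.1 e.2.2
  unfold wE
  split_ifs
  · have := hx e.1
    have := hx e.2.1
    have := hM e.1
    have := hM e.2.1
    calc _ ≤ a e.1 e.2.1 e.2.2 * M * M := by gcongr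
      _ = _ := by ring
  · positivity

namespace Approx
variable {a : ℕ → ℕ → ℕ → ℝ} {c0 : ℕ → ℝ} {M : ℝ} {B : ℝ → ℝ} {h : ℕ → ℝ}
    {τ : ℕ → ℝ} {X : ℕ → ℕ → ℕ → ℝ}

/-- integrated event density -/
noncomputable def In (a : ℕ → ℕ → ℕ → ℝ) (τ : ℕ → ℝ) (X : ℕ → ℕ → ℕ → ℝ) (n : ℕ)
    (e : ℕ × ℕ × ℕ) (t : ℝ) : ℝ := τ n * ∑ l ∈ range ⌊t / τ n⌋₊, wE a (X n l) e

lemma X_le (A : Approx a c0 M B h τ X) (n l i : ℕ) : X n l i ≤ M := by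
  have h1 := A.mass n l {i}
  rw [Finset.sum_singleton] at h1
  have h2 : 0 ≤ (i : ℝ) * X n l i := mul_nonneg (by positivity) (A.nonneg n l i)
  linarith

lemma w_nonneg (A : Approx a c0 M B h τ X) (n l : ℕ) (e : ℕ × ℕ × ℕ) : 0 ≤ wE a (X n l) e :=
  wE_nonneg A.ha (A.nonneg n l) e

lemma w_le (A : Approx a c0 M B h τ X) (n l : ℕ) (e : ℕ × ℕ × ℕ) :
    wE a (X n l) e ≤ a e.1 e.2.1 e.2.2 * M ^ 2 :=
  wE_le A.ha (A.nonneg n l) (A.X_le n l) e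

lemma F1 (A : Approx a c0 M B h τ X) (n m : ℕ) (t : ℝ) :
    X n ⌊t / τ n⌋₊ m = c0 m + ∑ e ∈ ebox n, In a τ X n e t * sg (dl m) e := A.rep n _ m

lemma floor_le (A : Approx a c0 M B h τ X) (n : ℕ) {t : ℝ} (ht : 0 ≤ t) :
    τ n * ⌊t / τ n⌋₊ ≤ t := by
  have hp := A.τpos n
  have := Nat.floor_le (div_nonneg ht hp.le)
  rw [le_div_iff₀ hp] at this
  linarith

lemma lt_floor (A : Approx a c0 M B h τ X) (n : ℕ) (t : ℝ) :
    t < τ n * ⌊t / τ n⌋₊ + τ n := by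
  have hp := A.τpos n
  have := Nat.lt_floor_add_one (t / τ n)
  rw [div_lt_iff₀ hp] at this
  linarith

lemma In_nonneg (A : Approx a c0 M B h τ X) (n : ℕ) (e : ℕ × ℕ × ℕ) (t : ℝ) :
    0 ≤ In a τ X n e t :=
  mul_nonneg (A.τpos n).le (Finset.sum_nonneg fun l _ => A.w_nonneg n l e)

lemma F2 (A : Approx a c0 M B h τ X) {n J : ℕ} (hJ : 1 ≤ J) {t : ℝ} (ht : 0 ≤ t)
    {S : Finset (ℕ × ℕ × ℕ)} (hS : S ⊆ ebox n) (hd : ∀ e ∈ S, e ∉ ebox J) :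
    ∑ e ∈ S, In a τ X n e t ≤ B t / h J := by
  refine le_trans ?_ (A.tail n J _ t hJ (A.floor_le n ht))
  unfold In
  rw [← Finset.mul_sum, Finset.sum_comm]
  refine mul_le_mul_of_nonneg_left (Finset.sum_le_sum fun l _ => ?_) (A.τpos n).le
  calc ∑ e ∈ S, wE a (X n l) e
      = ∑ e ∈ S, wE a (X n l) e * (if e ∈ ebox J then 0 else 1) := by
        refine Finset.sum_congr rfl fun e he => ?_
        simp [hd e he]
    _ ≤ _ := Finset.sum_le_sum_of_subset_of_nonneg hS (fun e _ _ =>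
        mul_nonneg (A.w_nonneg n l e) (by split_ifs <;> norm_num))

lemma F3 (A : Approx a c0 M B h τ X) (n : ℕ) (e : ℕ × ℕ × ℕ) {s t : ℝ} (hs : 0 ≤ s) (hst : s ≤ t) :
    0 ≤ In a τ X n e t - In a τ X n e s ∧
    In a τ X n e t - In a τ X n e s ≤ a e.1 e.2.1 e.2.2 * M ^ 2 * (t - s + τ n) := by
  have hp := A.τpos n
  have hfl : ⌊s / τ n⌋₊ ≤ ⌊t / τ n⌋₊ := Nat.floor_mono (by gcongr)
  have hEq : In a τ X n e t - In a τ X n e s =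
      τ n * ∑ l ∈ Finset.Ico ⌊s / τ n⌋₊ ⌊t / τ n⌋₊, wE a (X n l) e := by
    unfold In
    rw [Finset.sum_Ico_eq_sub _ hfl]
    ring
  rw [hEq]
  refine ⟨mul_nonneg hp.le (Finset.sum_nonneg fun l _ => A.w_nonneg n l e), ?_⟩
  have h1 : ∑ l ∈ Finset.Ico ⌊s / τ n⌋₊ ⌊t / τ n⌋₊, wE a (X n l) e ≤
      ((⌊t / τ n⌋₊ : ℝ) - ⌊s / τ n⌋₊) * (a e.1 e.2.1 e.2.2 * M ^ 2) := by
    refine (Finset.sum_le_card_nsmul _ _ _ (fun l _ => A.w_le n l e)).trans ?_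
    rw [Nat.card_Ico, nsmul_eq_mul, Nat.cast_sub hfl]
  have h2 := A.floor_le n (hs.trans hst)
  have h3 := A.lt_floor n s
  have h4 : 0 ≤ a e.1 e.2.1 e.2.2 * M ^ 2 := mul_nonneg (A.ha _ _ _) (sq_nonneg _)
  calc _ ≤ τ n * (((⌊t / τ n⌋₊ : ℝ) - ⌊s / τ n⌋₊) * (a e.1 e.2.1 e.2.2 * M ^ 2)) := by gcongr
    _ = a e.1 e.2.1 e.2.2 * M ^ 2 * (τ n * ⌊t / τ n⌋₊ - τ n * ⌊s / τ n⌋₊) := by ring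
    _ ≤ _ := by
      refine mul_le_mul_of_nonneg_left ?_ h4
      linarith

/-- modulus constant -/
noncomputable def Km (a : ℕ → ℕ → ℕ → ℝ) (M : ℝ) (J : ℕ) : ℝ :=
  2 * ∑ e ∈ ebox J, a e.1 e.2.1 e.2.2 * M ^ 2

lemma F5 (A : Approx a c0 M B h τ X) (n m : ℕ) {s t : ℝ} (hs : 0 ≤ s) (hst : s ≤ t) {T : ℝ}
    (htT : t ≤ T) {J : ℕ} (hJ : 1 ≤ J) :
    |X n ⌊t / τ n⌋₊ m - X n ⌊s / τ n⌋₊ m| ≤ Km a M J * (t - s + τ n) + 2 * B T / h J := by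
  rw [A.F1, A.F1, add_sub_add_left_eq_sub, ← Finset.sum_sub_distrib]
  have hhJ : 0 < h J := by have := A.h1 J; linarith
  have hp := A.τpos n
  calc |∑ e ∈ ebox n, (In a τ X n e t * sg (dl m) e - In a τ X n e s * sg (dl m) e)|
      ≤ ∑ e ∈ ebox n, 2 * (In a τ X n e t - In a τ X n e s) := by
        refine (Finset.abs_sum_le_sum_abs _ _).trans (Finset.sum_le_sum fun e _ => ?_)
        rw [← sub_mul, abs_mul, abs_of_nonneg (A.F3 n e hs hst).1, mul_comm]
        exact mul_le_mul_of_nonneg_right (sg_dl_abs m e) (A.F3 n e hs hst).1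
    _ = 2 * (∑ e ∈ (ebox n).filter (· ∈ ebox J), (In a τ X n e t - In a τ X n e s) +
          ∑ e ∈ (ebox n).filter (¬ · ∈ ebox J), (In a τ X n e t - In a τ X n e s)) := by
        rw [Finset.sum_filter_add_sum_filter_not, Finset.mul_sum]
    _ ≤ 2 * (∑ e ∈ ebox J, a e.1 e.2.1 e.2.2 * M ^ 2 * (t - s + τ n) + B T / h J) := by
        have e1 : ∑ e ∈ (ebox n).filter (· ∈ ebox J), (In a τ X n e t - In a τ X n e s) ≤
            ∑ e ∈ ebox J, a e.1 e.2.1 e.2.2 * M ^ 2 * (t - s + τ n) := by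
          refine (Finset.sum_le_sum fun e _ => (A.F3 n e hs hst).2).trans ?_
          refine Finset.sum_le_sum_of_subset_of_nonneg (fun e he => (Finset.mem_filter.1 he).2) ?_
          intro e _ _
          exact mul_nonneg (mul_nonneg (A.ha _ _ _) (sq_nonneg _)) (by linarith)
        have e2 : ∑ e ∈ (ebox n).filter (¬ · ∈ ebox J), (In a τ X n e t - In a τ X n e s) ≤
            B T / h J := by
          have e3 := A.F2 (S := (ebox n).filter (¬ · ∈ ebox J)) hJ (hs.trans hst)
            (Finset.filter_subset _ _) (fun e he => (Finset.mem_filter.1 he).2)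
          have e4 : B t / h J ≤ B T / h J :=
            div_le_div_of_nonneg_right (A.Bmono t T (hs.trans hst) htT) hhJ.le
          refine le_trans (Finset.sum_le_sum fun e _ => ?_) (e3.trans e4)
          linarith [A.In_nonneg n e s]
        linarith
    _ = _ := by
        unfold Km
        rw [← Finset.sum_mul]
        ring

end Approx

open Finset MeasureTheory Filter Topology

lemma cauchySeq_of_approx {u : ℕ → ℝ}
    (H : ∀ ε > 0, ∃ v : ℕ → ℝ, CauchySeq v ∧ ∀ᶠ n in atTop, |u n - v n| ≤ ε) : CauchySeq u := by
  rw [Metric.cauchySeq_iff']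
  intro ε hε
  obtain ⟨v, hv, huv⟩ := H (ε / 4) (by positivity)
  obtain ⟨N1, hN1⟩ := eventually_atTop.1 huv
  rw [Metric.cauchySeq_iff] at hv
  obtain ⟨N2, hN2⟩ := hv (ε / 4) (by positivity)
  refine ⟨max N1 N2, fun n hn => ?_⟩
  have e1 := hN1 n ((le_max_left _ _).trans hn)
  have e2 := hN1 (max N1 N2) (le_max_left _ _)
  have e3 := hN2 n ((le_max_right _ _).trans hn) (max N1 N2) (le_max_right _ _)
  rw [Real.dist_eq] at e3 ⊢
  rw [abs_le] at e1 e2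
  rw [abs_lt] at e3 ⊢
  constructor <;> linarith [e1.1, e1.2, e2.1, e2.2, e3.1, e3.2]

namespace Approx
variable {a : ℕ → ℕ → ℕ → ℝ} {c0 : ℕ → ℝ} {M : ℝ} {B : ℝ → ℝ} {h : ℕ → ℝ}
    {τ : ℕ → ℝ} {X : ℕ → ℕ → ℕ → ℝ}

lemma small (A : Approx a c0 M B h τ X) (b : ℝ) {ε : ℝ} (hε : 0 < ε) :
    ∃ J, 1 ≤ J ∧ b / h J ≤ ε := by
  have h1 : Tendsto (fun J => b / h J) atTop (𝓝 0) := tendsto_const_nhds.div_atTop A.hlim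
  obtain ⟨J, hJ⟩ := ((h1.eventually (gt_mem_nhds hε)).and (eventually_ge_atTop 1)).exists
  exact ⟨J, hJ.2, hJ.1.le⟩

lemma Km_nonneg (A : Approx a c0 M B h τ X) (J : ℕ) : 0 ≤ Km a M J :=
  mul_nonneg (by norm_num) (Finset.sum_nonneg fun e _ => mul_nonneg (A.ha _ _ _) (sq_nonneg _))

lemma subseq (A : Approx a c0 M B h τ X) : ∃ ψ : ℕ → ℕ, StrictMono ψ ∧
    ∀ m t, ∃ y, Tendsto (fun n => X (ψ n) ⌊t / τ (ψ n)⌋₊ m) atTop (𝓝 y) := by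
  have hK : IsCompact (Set.pi Set.univ (fun _ : ℕ × ℚ => Set.Icc (0:ℝ) M)) :=
    isCompact_univ_pi fun _ => isCompact_Icc
  obtain ⟨y, -, ψ, hψ, hlim⟩ := hK.tendsto_subseq
    (x := fun n (p : ℕ × ℚ) => X n ⌊(p.2 : ℝ) / τ n⌋₊ p.1)
    (fun n p _ => ⟨A.nonneg _ _ _, A.X_le _ _ _⟩)
  rw [tendsto_pi_nhds] at hlim
  refine ⟨ψ, hψ, fun m t => ?_⟩
  rcases lt_or_ge t 0 with ht | ht
  · refine ⟨c0 m, ?_⟩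
    have : ∀ n, X (ψ n) ⌊t / τ (ψ n)⌋₊ m = c0 m := fun n => by
      rw [Nat.floor_of_nonpos (div_nonpos_of_nonpos_of_nonneg ht.le (A.τpos _).le), A.atZero]
    simp only [this]
    exact tendsto_const_nhds
  refine cauchySeq_tendsto_of_complete (cauchySeq_of_approx fun ε hε => ?_)
  obtain ⟨J, hJ, hJε⟩ := A.small (2 * B (t + 1)) (half_pos hε)
  have hKm := A.Km_nonneg J
  set δ : ℝ := min 1 (ε / (4 * (Km a M J + 1))) with hδ
  have hδ0 : 0 < δ := lt_min one_pos (by positivity)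
  obtain ⟨r, hr1, hr2⟩ := exists_rat_btwn (show t < t + δ by linarith)
  refine ⟨fun n => X (ψ n) ⌊(r : ℝ) / τ (ψ n)⌋₊ m, (hlim (m, r)).cauchySeq, ?_⟩
  have hτ0 := (A.τlim.comp hψ.tendsto_atTop).eventually
    (gt_mem_nhds (show 0 < ε / (4 * (Km a M J + 1)) by positivity))
  filter_upwards [hτ0] with n hn
  have hn' : τ (ψ n) < ε / (4 * (Km a M J + 1)) := hn
  have hδ1 : δ ≤ 1 := min_le_left _ _
  have hδ2 : δ ≤ ε / (4 * (Km a M J + 1)) := min_le_right _ _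
  have := A.F5 (ψ n) m ht hr1.le (T := t + 1) (by linarith) hJ
  rw [abs_sub_comm]
  refine this.trans ?_
  have e1 : (r : ℝ) - t + τ (ψ n) ≤ 2 * (ε / (4 * (Km a M J + 1))) := by linarith
  have e2 : Km a M J * (2 * (ε / (4 * (Km a M J + 1)))) ≤ ε / 2 := by
    have e3 : (Km a M J + 1) * (2 * (ε / (4 * (Km a M J + 1)))) = ε / 2 := by
      field_simp; ring
    rw [← e3]
    gcongr
    linarith
  have e4 := mul_le_mul_of_nonneg_left e1 hKm
  linarith

/-- Properties of the limit -/
structure Lim (a : ℕ → ℕ → ℕ → ℝ) (c0 : ℕ → ℝ) (M : ℝ) (B : ℝ → ℝ) (h : ℕ → ℝ)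
    (τ : ℕ → ℝ) (X : ℕ → ℕ → ℕ → ℝ) (ψ : ℕ → ℕ) (c : ℕ → ℝ → ℝ) : Prop where
  A : Approx a c0 M B h τ X
  mono : StrictMono ψ
  lim : ∀ m t, Tendsto (fun n => X (ψ n) ⌊t / τ (ψ n)⌋₊ m) atTop (𝓝 (c m t))

namespace Lim
variable {ψ : ℕ → ℕ} {c : ℕ → ℝ → ℝ}

lemma nonneg (L : Lim a c0 M B h τ X ψ c) (m : ℕ) (t : ℝ) : 0 ≤ c m t :=
  ge_of_tendsto' (L.lim m t) fun n => L.A.nonneg _ _ _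

lemma le (L : Lim a c0 M B h τ X ψ c) (m : ℕ) (t : ℝ) : c m t ≤ M :=
  le_of_tendsto' (L.lim m t) fun n => L.A.X_le _ _ _

lemma summ (L : Lim a c0 M B h τ X ψ c) (t : ℝ) : Summable (fun i : ℕ => (1 + (i : ℝ)) * c i t) := by
  refine summable_of_sum_le (c := M) (fun i => mul_nonneg (by positivity) (L.nonneg i t)) fun S => ?_
  exact le_of_tendsto' (tendsto_finset_sum S fun i _ => (L.lim i t).const_mul (1 + (i : ℝ)))
    fun n => L.A.mass _ _ S

lemma atZero (L : Lim a c0 M B h τ X ψ c) (m : ℕ) : c m 0 = c0 m := by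
  refine tendsto_nhds_unique (L.lim m 0) ?_
  simp [L.A.atZero]

lemma τlim (L : Lim a c0 M B h τ X ψ c) : Tendsto (fun n => τ (ψ n)) atTop (𝓝 0) :=
  L.A.τlim.comp L.mono.tendsto_atTop

lemma modulus (L : Lim a c0 M B h τ X ψ c) (m : ℕ) {s t : ℝ} (hs : 0 ≤ s) (hst : s ≤ t) {T : ℝ}
    (htT : t ≤ T) {J : ℕ} (hJ : 1 ≤ J) :
    |c m t - c m s| ≤ Km a M J * (t - s) + 2 * B T / h J := by
  have h1 := ((L.lim m t).sub (L.lim m s)).abs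
  have h2 : Tendsto (fun n => Km a M J * (t - s + τ (ψ n)) + 2 * B T / h J) atTop
      (𝓝 (Km a M J * (t - s + 0) + 2 * B T / h J)) :=
    ((L.τlim.const_add (t - s)).const_mul _).add_const _
  rw [add_zero] at h2
  exact le_of_tendsto_of_tendsto' h1 h2 fun n => L.A.F5 (ψ n) m hs hst htT hJ

lemma cont (L : Lim a c0 M B h τ X ψ c) (m : ℕ) : ContinuousOn (c m) (Set.Ici 0) := by
  intro t ht
  rw [Metric.continuousWithinAt_iff]
  intro ε hε
  obtain ⟨J, hJ, hJε⟩ := L.A.small (2 * B (t + 1)) (half_pos hε)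
  have hKm := L.A.Km_nonneg J
  refine ⟨min 1 (ε / (4 * (Km a M J + 1))), lt_min one_pos (by positivity), fun {s} hs hd => ?_⟩
  rw [Real.dist_eq] at hd ⊢
  have hd1 := hd.trans_le (min_le_left _ _)
  have hd2 := hd.trans_le (min_le_right _ _)
  have key : |c m s - c m t| ≤ Km a M J * |s - t| + 2 * B (t + 1) / h J := by
    rw [abs_lt] at hd1
    rcases le_total s t with hst | hst
    · have := L.modulus m hs hst (T := t + 1) (by linarith) hJ
      rw [abs_sub_comm, abs_sub_comm s t, abs_of_nonneg (sub_nonneg.2 hst)]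
      exact this
    · have := L.modulus m ht hst (T := t + 1) (by linarith) hJ
      rw [abs_of_nonneg (sub_nonneg.2 hst)]
      exact this
  have e2 : Km a M J * (ε / (4 * (Km a M J + 1))) ≤ ε / 4 := by
    have e3 : (Km a M J + 1) * (ε / (4 * (Km a M J + 1))) = ε / 4 := by
      field_simp
    rw [← e3]
    gcongr
    linarith
  have e4 := mul_le_mul_of_nonneg_left hd2.le hKm
  linarith

/-- limiting event density -/
noncomputable def W (a : ℕ → ℕ → ℕ → ℝ) (c : ℕ → ℝ → ℝ) (e : ℕ × ℕ × ℕ) (s : ℝ) : ℝ :=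
  wE a (fun n => c n s) e

lemma W_nonneg (L : Lim a c0 M B h τ X ψ c) (e : ℕ × ℕ × ℕ) (s : ℝ) : 0 ≤ W a c e s :=
  wE_nonneg L.A.ha (fun i => L.nonneg i s) e

lemma W_cont (L : Lim a c0 M B h τ X ψ c) (e : ℕ × ℕ × ℕ) : ContinuousOn (W a c e) (Set.Ici 0) := by
  unfold W wE
  split_ifs
  · exact (continuousOn_const.mul (L.cont _)).mul (L.cont _)
  · exact continuousOn_const

lemma W_int (L : Lim a c0 M B h τ X ψ c) (e : ℕ × ℕ × ℕ) (t : ℝ) :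
    IntegrableOn (W a c e) (Set.Ioc 0 t) :=
  (((L.W_cont e).mono (fun _ hs => hs.1)).integrableOn_Icc (a := 0) (b := t)).mono_set
    Set.Ioc_subset_Icc_self

lemma In_lim (L : Lim a c0 M B h τ X ψ c) (e : ℕ × ℕ × ℕ) {t : ℝ} (ht : 0 ≤ t) :
    Tendsto (fun n => In a τ X (ψ n) e t) atTop (𝓝 (∫ s in (0:ℝ)..t, W a c e s)) := by
  set K := a e.1 e.2.1 e.2.2 * M ^ 2 with hK
  have hwabs : ∀ n l, |wE a (X n l) e| ≤ K := fun n l => by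
    rw [abs_of_nonneg (L.A.w_nonneg n l e)]
    exact L.A.w_le n l e
  have h1 : Tendsto (fun n => ∫ s in (0:ℝ)..t, wE a (X (ψ n) ⌊s / τ (ψ n)⌋₊) e) atTop
      (𝓝 (∫ s in (0:ℝ)..t, W a c e s)) := by
    refine intervalIntegral.tendsto_integral_filter_of_dominated_convergence (fun _ => K) ?_ ?_ ?_ ?_
    · exact Eventually.of_forall fun n =>
        (step_meas (fun l => wE a (X (ψ n) l) e) (τ (ψ n))).aestronglyMeasurable
    · exact Eventually.of_forall fun n => Eventually.of_forall fun s _ => hwabs _ _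
    · exact intervalIntegrable_const
    · refine Eventually.of_forall fun s _ => ?_
      unfold W wE
      split_ifs
      · exact ((L.lim _ s).const_mul _).mul (L.lim _ s)
      · exact tendsto_const_nhds
  have h2 : Tendsto (fun n => ∫ s in (τ (ψ n) * ⌊t / τ (ψ n)⌋₊)..t,
      wE a (X (ψ n) ⌊s / τ (ψ n)⌋₊) e) atTop (𝓝 0) := by
    have h3 : Tendsto (fun n => K * τ (ψ n)) atTop (𝓝 0) := by
      simpa using L.τlim.const_mul K
    refine squeeze_zero_norm (fun n => ?_) h3
    refine (intervalIntegral.norm_integral_le_of_norm_le_const (C := K) fun s _ => hwabs _ _).trans ?_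
    have hK0 : 0 ≤ K := (abs_nonneg _).trans (hwabs 0 0)
    have e1 := L.A.floor_le (ψ n) ht
    have e2 := L.A.lt_floor (ψ n) t
    rw [abs_of_nonneg (by linarith)]
    exact mul_le_mul_of_nonneg_left (by linarith) hK0
  have h4 := h1.sub h2
  rw [sub_zero] at h4
  refine h4.congr fun n => ?_
  have e1 := step_integral (fun l => wE a (X (ψ n) l) e) (L.A.τpos (ψ n)) (hwabs (ψ n)) ⌊t / τ (ψ n)⌋₊
  have e2 := intervalIntegral.integral_add_adjacent_intervals
    (step_intervalIntegrable (τ := τ (ψ n)) (fun l => wE a (X (ψ n) l) e) (hwabs (ψ n)) 0 (τ (ψ n) * ⌊t / τ (ψ n)⌋₊))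
    (step_intervalIntegrable (τ := τ (ψ n)) (fun l => wE a (X (ψ n) l) e) (hwabs (ψ n)) (τ (ψ n) * ⌊t / τ (ψ n)⌋₊) t)
  unfold In
  rw [← e1, ← e2]
  ring

lemma ebox_tendsto : Tendsto ebox atTop atTop := by
  refine tendsto_atTop_finset_of_monotone (fun n n' hn e he => ?_) (fun e => ?_)
  · obtain ⟨i, j, k⟩ := e
    rw [mem_ebox] at he ⊢
    omega
  · obtain ⟨i, j, k⟩ := e
    exact ⟨i + j + k, by rw [mem_ebox]; omega⟩

lemma tail_sum (L : Lim a c0 M B h τ X ψ c) {t : ℝ} (ht : 0 ≤ t) {J : ℕ} (hJ : 1 ≤ J)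
    {S : Finset (ℕ × ℕ × ℕ)} (hd : ∀ e ∈ S, e ∉ ebox J) :
    ∑ e ∈ S, ∫ s in (0:ℝ)..t, W a c e s ≤ B t / h J := by
  have h1 := tendsto_finset_sum S fun e _ => L.In_lim e ht
  refine le_of_tendsto h1 ?_
  filter_upwards [(ebox_tendsto.comp L.mono.tendsto_atTop).eventually (eventually_ge_atTop S)] with n hn
  exact L.A.F2 hJ ht hn hd

lemma I_nonneg (L : Lim a c0 M B h τ X ψ c) {t : ℝ} (ht : 0 ≤ t) (e : ℕ × ℕ × ℕ) :
    0 ≤ ∫ s in (0:ℝ)..t, W a c e s :=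
  intervalIntegral.integral_nonneg ht fun s _ => L.W_nonneg e s

lemma I_summable (L : Lim a c0 M B h τ X ψ c) {t : ℝ} (ht : 0 ≤ t) :
    Summable (fun e => ∫ s in (0:ℝ)..t, W a c e s) := by
  refine summable_of_sum_le (c := ∑ e ∈ ebox 1, (∫ s in (0:ℝ)..t, W a c e s) + B t / h 1)
    (L.I_nonneg ht) fun S => ?_
  rw [← Finset.sum_filter_add_sum_filter_not S (· ∈ ebox 1)]
  refine add_le_add ?_ (L.tail_sum ht le_rfl fun e he => (Finset.mem_filter.1 he).2)
  exact Finset.sum_le_sum_of_subset_of_nonneg (fun e he => (Finset.mem_filter.1 he).2)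
    fun e _ _ => L.I_nonneg ht e

lemma approx_eq (L : Lim a c0 M B h τ X ψ c) (m : ℕ) {t : ℝ} (ht : 0 ≤ t) {J : ℕ} (hJ : 1 ≤ J) :
    |c m t - c0 m - ∑ e ∈ ebox J, (∫ s in (0:ℝ)..t, W a c e s) * sg (dl m) e| ≤ 2 * (B t / h J) := by
  have h1 : Tendsto (fun n => |X (ψ n) ⌊t / τ (ψ n)⌋₊ m - c0 m -
      ∑ e ∈ ebox J, In a τ X (ψ n) e t * sg (dl m) e|) atTop
      (𝓝 |c m t - c0 m - ∑ e ∈ ebox J, (∫ s in (0:ℝ)..t, W a c e s) * sg (dl m) e|) :=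
    (((L.lim m t).sub_const _).sub
      (tendsto_finset_sum _ fun e _ => (L.In_lim e ht).mul_const _)).abs
  refine le_of_tendsto h1 ?_
  filter_upwards [(ebox_tendsto.comp L.mono.tendsto_atTop).eventually
    (eventually_ge_atTop (ebox J))] with n hn
  have hn' : ebox J ⊆ ebox (ψ n) := hn
  rw [L.A.F1, add_sub_cancel_left, ← Finset.sum_sdiff hn', add_sub_cancel_right]
  refine (Finset.abs_sum_le_sum_abs _ _).trans ?_
  have h2 := L.A.F2 (n := ψ n) hJ ht (S := ebox (ψ n) \ ebox J) Finset.sdiff_subset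
    (fun e he => (Finset.mem_sdiff.1 he).2)
  refine le_trans ?_ (mul_le_mul_of_nonneg_left h2 (by norm_num : (0:ℝ) ≤ 2))
  rw [Finset.mul_sum]
  refine Finset.sum_le_sum fun e _ => ?_
  rw [abs_mul, abs_of_nonneg (L.A.In_nonneg _ _ _), mul_comm]
  exact mul_le_mul_of_nonneg_right (sg_dl_abs m e) (L.A.In_nonneg _ _ _)

lemma limit_eq (L : Lim a c0 M B h τ X ψ c) (m : ℕ) {t : ℝ} (ht : 0 ≤ t) :
    c m t = c0 m + ∑' e, (∫ s in (0:ℝ)..t, W a c e s) * sg (dl m) e := by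
  have hs : Summable fun e => (∫ s in (0:ℝ)..t, W a c e s) * sg (dl m) e := by
    refine Summable.of_norm_bounded ((L.I_summable ht).mul_right 2) fun e => ?_
    rw [Real.norm_eq_abs, abs_mul, abs_of_nonneg (L.I_nonneg ht e)]
    exact mul_le_mul_of_nonneg_left (sg_dl_abs m e) (L.I_nonneg ht e)
  have h1 : Tendsto (fun J => ∑ e ∈ ebox J, (∫ s in (0:ℝ)..t, W a c e s) * sg (dl m) e) atTop
      (𝓝 (∑' e, (∫ s in (0:ℝ)..t, W a c e s) * sg (dl m) e)) := hs.hasSum.comp ebox_tendsto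
  have h2 : Tendsto (fun J => 2 * (B t / h J)) atTop (𝓝 0) := by
    have : Tendsto (fun J => B t / h J) atTop (𝓝 0) := tendsto_const_nhds.div_atTop L.A.hlim
    simpa using this.const_mul 2
  have h3 : Tendsto (fun J => c m t - c0 m -
      ∑ e ∈ ebox J, (∫ s in (0:ℝ)..t, W a c e s) * sg (dl m) e) atTop (𝓝 0) := by
    refine squeeze_zero_norm' ?_ h2
    filter_upwards [eventually_ge_atTop 1] with J hJ
    exact L.approx_eq m ht hJ
  have h4 := tendsto_nhds_unique h3 (h1.const_sub (c m t - c0 m))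
  linarith

end Lim
end Approx

open Finset MeasureTheory Filter Topology

lemma nonneg_series {α ι : Type*} [MeasurableSpace α] {μ : Measure α} [Countable ι]
    {F : ι → α → ℝ} (h0 : ∀ i s, 0 ≤ F i s) (hIntg : ∀ i, Integrable (F i) μ)
    (hsum : Summable fun i => ∫ s, F i s ∂μ) :
    (∀ᵐ s ∂μ, Summable fun i => F i s) ∧ Integrable (fun s => ∑' i, F i s) μ ∧
      HasSum (fun i => ∫ s, F i s ∂μ) (∫ s, ∑' i, F i s ∂μ) := by
  have hfin : ∫⁻ s, ∑' i, ENNReal.ofReal (F i s) ∂μ ≠ ⊤ := by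
    rw [lintegral_tsum fun i => (hIntg i).1.aemeasurable.ennreal_ofReal]
    have : ∀ i, ∫⁻ s, ENNReal.ofReal (F i s) ∂μ = ENNReal.ofReal (∫ s, F i s ∂μ) := fun i =>
      (ofReal_integral_eq_lintegral_ofReal (hIntg i) (Eventually.of_forall (h0 i))).symm
    simp only [this]
    exact hsum.tsum_ofReal_ne_top
  have hmeas : AEMeasurable (fun s => ∑' i, ENNReal.ofReal (F i s)) μ :=
    AEMeasurable.tsum fun i => (hIntg i).1.aemeasurable.ennreal_ofReal
  have hae : ∀ᵐ s ∂μ, Summable fun i => F i s := by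
    filter_upwards [ae_lt_top' hmeas hfin] with s hs
    have := ENNReal.summable_toReal hs.ne
    refine this.congr fun i => ?_
    exact ENNReal.toReal_ofReal (h0 i s)
  refine ⟨hae, ?_, ?_⟩
  · refine (integrable_toReal_of_lintegral_ne_top hmeas hfin).congr ?_
    refine Eventually.of_forall fun s => ?_
    dsimp only
    rw [ENNReal.tsum_toReal_eq fun i => ENNReal.ofReal_ne_top]
    exact tsum_congr fun i => ENNReal.toReal_ofReal (h0 i s)
  · refine hasSum_integral_of_summable_integral_norm hIntg ?_
    refine hsum.congr fun i => ?_
    refine integral_congr_ae (Eventually.of_forall fun s => ?_)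
    exact (Real.norm_of_nonneg (h0 i s)).symm

lemma dl_self (m : ℕ) : dl m m = 1 := by simp [dl]

lemma mem_of_dl {m r : ℕ} {w : ℝ} (hne : w * dl m r ≠ 0) : w ≠ 0 ∧ r = m := by
  refine ⟨left_ne_zero_of_mul hne, ?_⟩
  by_contra hr
  exact (right_ne_zero_of_mul hne) (by simp [dl, hr])

lemma of_wE_ne {a : ℕ → ℕ → ℕ → ℝ} {x : ℕ → ℝ} {i j k : ℕ} (hne : wE a x (i, j, k) ≠ 0) :
    1 ≤ k ∧ k ≤ i := by
  by_contra hk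
  exact hne (by simp only [wE]; rw [if_neg hk])

section ident
variable (a : ℕ → ℕ → ℕ → ℝ) (x : ℕ → ℝ) (m : ℕ)

lemma t1 (p : ℕ × ℕ) : (if 1 ≤ p.1 then a (m + p.1) p.2 p.1 * x (m + p.1) * x p.2 else 0) =
    wE a x (m + p.1, p.2, p.1) := by
  simp [wE]

lemma t2 (p : ℕ × ℕ) : (if 1 ≤ p.1 ∧ p.1 ≤ p.2 then a p.2 m p.1 * x p.2 * x m else 0) =
    wE a x (p.2, m, p.1) := by
  simp [wE]

lemma t3 {k : ℕ} (hk : k ∈ Icc 1 m) (j : ℕ) :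
    (if k ≤ j then a j (m - k) k * x j * x (m - k) else 0) = wE a x (j, m - k, k) := by
  simp [wE, (mem_Icc.1 hk).1]

lemma t4 {k : ℕ} (hk : k ∈ Icc 1 m) (j : ℕ) : a m j k * x j * x m = wE a x (m, j, k) := by
  simp only [wE]
  rw [if_pos (mem_Icc.1 hk)]
  ring

lemma i1 : Function.Injective (fun p : ℕ × ℕ => ((m + p.1, p.2, p.1) : ℕ × ℕ × ℕ)) := by
  rintro ⟨p, p'⟩ ⟨r, r'⟩ h
  simp only [Prod.mk.injEq] at h ⊢
  omega

lemma i2 : Function.Injective (fun p : ℕ × ℕ => ((p.2, m, p.1) : ℕ × ℕ × ℕ)) := by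
  rintro ⟨p, p'⟩ ⟨r, r'⟩ h
  simp only [Prod.mk.injEq] at h ⊢
  omega

lemma i3 (j k : ℕ) : Function.Injective (fun p : ℕ => ((p, j, k) : ℕ × ℕ × ℕ)) := by
  rintro p r h
  simp only [Prod.mk.injEq] at h
  omega

lemma i4 (j k : ℕ) : Function.Injective (fun p : ℕ => ((j, p, k) : ℕ × ℕ × ℕ)) := by
  rintro p r h
  simp only [Prod.mk.injEq] at h
  omega

lemma qsummable_of (hs : Summable (wE a x)) : QSummable a x m := by
  refine ⟨?_, ?_, fun k hk => ?_, fun k hk => ?_⟩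
  · simp only [t1]
    exact hs.comp_injective (i1 m)
  · simp only [t2]
    exact hs.comp_injective (i2 m)
  · simp only [t3 a x m hk]
    exact hs.comp_injective (i3 _ _)
  · simp only [t4 a x m hk]
    exact hs.comp_injective (i4 _ _)

lemma Qi1_eq : Qi1 a x m = ∑' e : ℕ × ℕ × ℕ, wE a x e * dl m (e.1 - e.2.2) := by
  unfold Qi1
  simp only [t1]
  rw [← (i1 m).tsum_eq]
  · refine tsum_congr fun p => ?_
    simp [dl_self]
  · rintro ⟨i, j, k⟩ he
    obtain ⟨h1, h2⟩ := mem_of_dl he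
    obtain ⟨h3, h4⟩ := of_wE_ne h1
    simp only at h2
    refine ⟨(k, j), ?_⟩
    simp only [Prod.mk.injEq, and_true]
    omega

lemma Qi2_eq : Qi2 a x m = -∑' e : ℕ × ℕ × ℕ, wE a x e * dl m e.2.1 := by
  unfold Qi2
  simp only [t2]
  rw [← (i2 m).tsum_eq]
  · congr 1
    refine tsum_congr fun p => ?_
    simp [dl_self]
  · rintro ⟨i, j, k⟩ he
    obtain ⟨h1, h2⟩ := mem_of_dl he
    simp only at h2
    exact ⟨(k, i), by simp [h2]⟩

lemma summable_ite (hs : Summable (wE a x)) (p : ℕ × ℕ × ℕ → Prop) [DecidablePred p] :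
    Summable fun e => if p e then wE a x e else 0 := by
  refine Summable.of_norm_bounded hs.norm fun e => ?_
  split_ifs
  · exact le_rfl
  · simp

lemma Qi3_eq (hs : Summable (wE a x)) :
    Qi3 a x m = ∑' e : ℕ × ℕ × ℕ, wE a x e * dl m (e.2.1 + e.2.2) := by
  have h1 : Qi3 a x m = ∑ k ∈ Icc 1 m, ∑' e : ℕ × ℕ × ℕ,
      if e.2.2 = k ∧ e.2.1 = m - k then wE a x e else 0 := by
    unfold Qi3
    refine Finset.sum_congr rfl fun k hk => ?_
    simp only [t3 a x m hk]
    rw [← (i3 (m - k) k).tsum_eq]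
    · simp
    · rintro ⟨i, j, k'⟩ he
      have : k' = k ∧ j = m - k := by
        by_contra hn
        exact he (if_neg hn)
      exact ⟨i, by simp [this.1, this.2]⟩
  rw [h1, ← Summable.tsum_finsetSum fun k _ => summable_ite a x hs _]
  refine tsum_congr fun e => ?_
  obtain ⟨i, j, k⟩ := e
  dsimp only
  by_cases hw : wE a x (i, j, k) = 0
  · simp [hw]
  obtain ⟨h3, h4⟩ := of_wE_ne hw
  by_cases hm : j + k = m
  · rw [Finset.sum_eq_single k]
    · rw [if_pos ⟨rfl, by omega⟩, hm, dl_self, mul_one]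
    · intro k' _ hne
      rw [if_neg]
      omega
    · intro hk
      rw [mem_Icc] at hk
      omega
  · rw [Finset.sum_eq_zero]
    · simp [dl, hm]
    · intro k' hk'
      rw [mem_Icc] at hk'
      rw [if_neg]
      omega

lemma Qi4_eq (hs : Summable (wE a x)) :
    Qi4 a x m = -∑' e : ℕ × ℕ × ℕ, wE a x e * dl m e.1 := by
  have h1 : Qi4 a x m = -∑ k ∈ Icc 1 m, ∑' e : ℕ × ℕ × ℕ,
      if e.2.2 = k ∧ e.1 = m then wE a x e else 0 := by
    unfold Qi4
    congr 1
    refine Finset.sum_congr rfl fun k hk => ?_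
    simp only [t4 a x m hk]
    rw [← (i4 m k).tsum_eq]
    · simp
    · rintro ⟨i, j, k'⟩ he
      have : k' = k ∧ i = m := by
        by_contra hn
        exact he (if_neg hn)
      exact ⟨j, by simp [this.1, this.2]⟩
  rw [h1, ← Summable.tsum_finsetSum fun k _ => summable_ite a x hs _]
  congr 1
  refine tsum_congr fun e => ?_
  obtain ⟨i, j, k⟩ := e
  dsimp only
  by_cases hw : wE a x (i, j, k) = 0
  · simp [hw]
  obtain ⟨h3, h4⟩ := of_wE_ne hw
  by_cases hm : i = m
  · rw [Finset.sum_eq_single k]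
    · rw [if_pos ⟨rfl, hm⟩, hm, dl_self, mul_one]
    · intro k' _ hne
      rw [if_neg]
      omega
    · intro hk
      rw [mem_Icc] at hk
      omega
  · rw [Finset.sum_eq_zero]
    · simp [dl, hm]
    · intro k' hk'
      rw [if_neg]
      omega

end ident

namespace Approx.Lim
variable {a : ℕ → ℕ → ℕ → ℝ} {c0 : ℕ → ℝ} {M : ℝ} {B : ℝ → ℝ} {h : ℕ → ℝ}
    {τ : ℕ → ℝ} {X : ℕ → ℕ → ℕ → ℝ} {ψ : ℕ → ℕ} {c : ℕ → ℝ → ℝ}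

lemma series (L : Lim a c0 M B h τ X ψ c) {t : ℝ} (ht : 0 ≤ t) (b : ℕ × ℕ × ℕ → ℝ)
    (hb0 : ∀ e, 0 ≤ b e) (hb1 : ∀ e, b e ≤ 1) :
    (∀ᵐ s ∂(volume.restrict (Set.Ioc 0 t)), Summable fun e => W a c e s * b e) ∧
    IntegrableOn (fun s => ∑' e, W a c e s * b e) (Set.Ioc 0 t) ∧
    HasSum (fun e => (∫ s in (0:ℝ)..t, W a c e s) * b e)
      (∫ s in Set.Ioc 0 t, ∑' e, W a c e s * b e) := by
  have hI : ∀ e, ∫ s in Set.Ioc 0 t, W a c e s * b e = (∫ s in (0:ℝ)..t, W a c e s) * b e := by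
    intro e
    rw [integral_mul_const, intervalIntegral.integral_of_le ht]
  have := nonneg_series (μ := volume.restrict (Set.Ioc 0 t)) (F := fun e s => W a c e s * b e)
    (fun e s => mul_nonneg (L.W_nonneg e s) (hb0 e)) (fun e => (L.W_int e t).mul_const _) (by
      simp only [hI]
      exact Summable.of_nonneg_of_le (fun e => mul_nonneg (L.I_nonneg ht e) (hb0 e))
        (fun e => mul_le_of_le_one_right (L.I_nonneg ht e) (hb1 e)) (L.I_summable ht))
  simp only [hI] at this
  exact this

lemma mild (L : Lim a c0 M B h τ X ψ c) : MildSolIso a c0 (Set.Ici 0) c := by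
  refine ⟨L.atZero, fun t _ => ⟨fun i => L.nonneg i t, L.summ t⟩, L.cont, fun m t ht => ?_⟩
  have ht : 0 ≤ t := ht
  have d0 : ∀ r, 0 ≤ dl m r := fun r => by unfold dl; split_ifs <;> norm_num
  have d1 : ∀ r, dl m r ≤ 1 := fun r => by unfold dl; split_ifs <;> norm_num
  obtain ⟨hae, -, -⟩ := L.series ht (fun _ => 1) (fun _ => zero_le_one) (fun _ => le_rfl)
  obtain ⟨-, q1, s1⟩ := L.series ht (fun e => dl m (e.1 - e.2.2)) (fun e => d0 _) (fun e => d1 _)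
  obtain ⟨-, q2, s2⟩ := L.series ht (fun e => dl m e.2.1) (fun e => d0 _) (fun e => d1 _)
  obtain ⟨-, q3, s3⟩ := L.series ht (fun e => dl m (e.2.1 + e.2.2)) (fun e => d0 _) (fun e => d1 _)
  obtain ⟨-, q4, s4⟩ := L.series ht (fun e => dl m e.1) (fun e => d0 _) (fun e => d1 _)
  have hae' : ∀ᵐ s ∂(volume.restrict (Set.Ioc 0 t)), Summable (wE a (fun n => c n s)) := by
    filter_upwards [hae] with s hs
    simpa [W] using hs
  have e1 : (fun s => ∑' e, W a c e s * dl m (e.1 - e.2.2))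
      =ᵐ[volume.restrict (Set.Ioc 0 t)] fun s => Qi1 a (fun n => c n s) m :=
    Eventually.of_forall fun s => (Qi1_eq a _ m).symm
  have e2 : (fun s => -∑' e, W a c e s * dl m e.2.1)
      =ᵐ[volume.restrict (Set.Ioc 0 t)] fun s => Qi2 a (fun n => c n s) m :=
    Eventually.of_forall fun s => (Qi2_eq a _ m).symm
  have e3 : (fun s => ∑' e, W a c e s * dl m (e.2.1 + e.2.2))
      =ᵐ[volume.restrict (Set.Ioc 0 t)] fun s => Qi3 a (fun n => c n s) m := by
    filter_upwards [hae'] with s hs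
    exact (Qi3_eq a _ m hs).symm
  have e4 : (fun s => -∑' e, W a c e s * dl m e.1)
      =ᵐ[volume.restrict (Set.Ioc 0 t)] fun s => Qi4 a (fun n => c n s) m := by
    filter_upwards [hae'] with s hs
    exact (Qi4_eq a _ m hs).symm
  have r1 : IntegrableOn (fun s => Qi1 a (fun n => c n s) m) (Set.Ioc 0 t) := Integrable.congr q1 e1
  have r2 : IntegrableOn (fun s => Qi2 a (fun n => c n s) m) (Set.Ioc 0 t) :=
    Integrable.congr (Integrable.neg q2) e2
  have r3 : IntegrableOn (fun s => Qi3 a (fun n => c n s) m) (Set.Ioc 0 t) := Integrable.congr q3 e3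
  have r4 : IntegrableOn (fun s => Qi4 a (fun n => c n s) m) (Set.Ioc 0 t) :=
    Integrable.congr (Integrable.neg q4) e4
  refine ⟨?_, r1, r2, r3, r4, ?_⟩
  · filter_upwards [hae'] with s hs
    exact qsummable_of a _ m hs
  · rw [L.limit_eq m ht, intervalIntegral.integral_of_le ht]
    congr 1
    rw [integral_add (f := fun s => Qi1 a (fun n => c n s) m + Qi2 a (fun n => c n s) m +
        Qi3 a (fun n => c n s) m) ((r1.add r2).add r3) r4,
      integral_add (f := fun s => Qi1 a (fun n => c n s) m + Qi2 a (fun n => c n s) m)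
        (r1.add r2) r3, integral_add r1 r2,
      ← integral_congr_ae e1, ← integral_congr_ae e2, ← integral_congr_ae e3,
      ← integral_congr_ae e4, integral_neg, integral_neg]
    have hsum := ((s1.add s3).sub s4).sub s2
    have : HasSum (fun e => (∫ s in (0:ℝ)..t, W a c e s) * sg (dl m) e) _ :=
      HasSum.congr_fun hsum fun e => by
        unfold sg
        ring
    rw [this.tsum_eq]
    ring

end Approx.Lim

/-- Theorem 5.1: existence of a global mild solution of the isolated DGED system. -/
theorem exists_global_mild_solution_isolated
    (a : ℕ → ℕ → ℕ → ℝ) (ha : ∀ i j k, 0 ≤ a i j k)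
    (hzero : ∀ p : ℕ, 1 ≤ p → a p 0 p = 0)
    (C Q : ℝ) (q : ℕ → ℕ → ℝ) (hGB : GB a C Q q)
    (c0 : ℕ → ℝ) (hc0 : ∀ i, 0 ≤ c0 i)
    (hX : Summable (fun i : ℕ => (1 + (i : ℝ)) * c0 i)) :
    ∃ c : ℕ → ℝ → ℝ, MildSolIso a c0 (Set.Ici 0) c := by
  obtain ⟨M, B, h, τ, X, A⟩ := approx_exists a ha hzero C Q q hGB c0 hc0 hX
  obtain ⟨ψ, hψ, hlim⟩ := A.subseq
  choose c hc using hlim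
  exact ⟨c, Approx.Lim.mild ⟨A, hψ, hc⟩⟩
end

section
/- Let c_0 = (c_{0i})_{i≥0} ∈ X_{0,1}^+ and assume the rate coefficients satisfy the growth condition (GB). Then the initial value problem for the non-isolated DGED system with initial datum c_0 has at least one global mild solution c defined on the interval [0,∞). -/
open Finset MeasureTheory

namespace DGED

/-- weight ratio -/
noncomputable def phi (N i : ℕ) : ℝ := (i : ℝ) / ((i : ℝ) + N)

/-- superlinear-type weight -/
noncomputable def gw (N i : ℕ) : ℝ := (i : ℝ) * phi N i

lemma phi_nonneg (N i : ℕ) : 0 ≤ phi N i := by unfold phi; positivity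
lemma gw_nonneg (N i : ℕ) : 0 ≤ gw N i := mul_nonneg (by positivity) (phi_nonneg N i)
lemma gw_zero (N : ℕ) : gw N 0 = 0 := by simp [gw]
lemma phi_le_one (N i : ℕ) : phi N i ≤ 1 := by
  unfold phi
  exact div_le_one_of_le₀ (by simp) (by positivity)
lemma gw_le (N i : ℕ) : gw N i ≤ i := by
  have := phi_le_one N i
  unfold gw
  exact mul_le_of_le_one_right (by positivity) this

lemma phi_mono (N : ℕ) (hN : 1 ≤ N) {k i : ℕ} (h : k ≤ i) : phi N k ≤ phi N i := by
  unfold phi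
  have hN' : (1 : ℝ) ≤ N := by exact_mod_cast hN
  have h' : (k : ℝ) ≤ i := by exact_mod_cast h
  rw [div_le_div_iff₀ (by positivity) (by positivity)]
  nlinarith

lemma gw_super (N : ℕ) (hN : 1 ≤ N) (i j : ℕ) : gw N i + gw N j ≤ gw N (i + j) := by
  have h1 := phi_mono N hN (Nat.le_add_right i j)
  have h2 := phi_mono N hN (Nat.le_add_left j i)
  unfold gw
  push_cast
  have : (0 : ℝ) ≤ i := by positivity
  have : (0 : ℝ) ≤ j := by positivity
  nlinarith

lemma phi_half (N : ℕ) (hN : 1 ≤ N) {i : ℕ} (h : N ≤ i) : 1 ≤ 2 * phi N i := by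
  unfold phi
  have hN' : (1 : ℝ) ≤ N := by exact_mod_cast hN
  have h' : (N : ℝ) ≤ i := by exact_mod_cast h
  rw [← mul_div_assoc, le_div_iff₀ (by positivity)]
  linarith

lemma gw_diff (N : ℕ) (hN : 1 ≤ N) (j k : ℕ) : gw N (j + k) - gw N j - gw N k =
    (j * k * N * (j + k + 2 * N) : ℝ) / ((j + k + N) * (j + N) * (k + N)) := by
  have hN' : (1 : ℝ) ≤ N := by exact_mod_cast hN
  have h1 : (j + k + N : ℝ) ≠ 0 := by positivity
  have h2 : (j + N : ℝ) ≠ 0 := by positivity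
  have h3 : (k + N : ℝ) ≠ 0 := by positivity
  unfold gw phi
  push_cast
  field_simp
  ring

lemma gw_strict_aux (N x y : ℝ) (hN : 1 ≤ N) (hx : 1 ≤ x) (hy : 1 ≤ y) (h : N ≤ x + y)
    (hxy : y ≤ x) :
    1 / 6 ≤ (x * y * N * (x + y + 2 * N)) / ((x + y + N) * (x + N) * (y + N)) := by
  have e : (x * y * N * (x + y + 2 * N)) / ((x + y + N) * (x + N) * (y + N))
    = (x / (x + N)) * (y * N / (y + N)) * ((x + y + 2 * N) / (x + y + N)) := by
    field_simp
  rw [e]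
  have h1 : 1 / 3 ≤ x / (x + N) := by
    rw [div_le_div_iff₀ (by positivity) (by positivity)]; linarith
  have h2 : 1 / 2 ≤ y * N / (y + N) := by
    rw [div_le_div_iff₀ (by positivity) (by positivity)]; nlinarith
  have h3 : 1 ≤ (x + y + 2 * N) / (x + y + N) := by
    rw [le_div_iff₀ (by positivity)]; linarith
  calc (1 / 6 : ℝ) = 1 / 3 * (1 / 2) * 1 := by norm_num
    _ ≤ _ := by gcongr

lemma gw_strict (N : ℕ) (hN : 1 ≤ N) (j k : ℕ) (hj : 1 ≤ j) (hk : 1 ≤ k) (h : N ≤ j + k) :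
    1 / 6 ≤ gw N (j + k) - gw N j - gw N k := by
  rw [gw_diff N hN]
  have hN' : (1 : ℝ) ≤ N := by exact_mod_cast hN
  have hj' : (1 : ℝ) ≤ j := by exact_mod_cast hj
  have hk' : (1 : ℝ) ≤ k := by exact_mod_cast hk
  have h' : (N : ℝ) ≤ j + k := by exact_mod_cast h
  rcases le_total (k : ℝ) j with hh | hh
  · exact gw_strict_aux _ _ _ hN' hj' hk' h' hh
  · have := gw_strict_aux _ _ _ hN' hk' hj' (by linarith) hh
    refine this.trans (le_of_eq ?_)
    congr 1 <;> ring

lemma gw_bound (N : ℕ) (hN : 1 ≤ N) (j k : ℕ) :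
    ((j : ℝ) + k) * (gw N (j + k) - gw N j - gw N k) ≤ 2 * (j * gw N k + k * gw N j) := by
  rw [gw_diff N hN]
  have hN' : (1 : ℝ) ≤ N := by exact_mod_cast hN
  have e : 2 * ((j : ℝ) * gw N k + k * gw N j)
    = (2 * (j * k * (2 * j * k + N * (j + k))) * (j + k + N)) / ((j + k + N) * (j + N) * (k + N)) := by
    have h1 : (j + k + N : ℝ) ≠ 0 := by positivity
    have h2 : (j + N : ℝ) ≠ 0 := by positivity
    have h3 : (k + N : ℝ) ≠ 0 := by positivity
    unfold gw phi
    field_simp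
    ring
  rw [e, ← mul_div_assoc]
  apply div_le_div_of_nonneg_right _ (by positivity)
  have hx : (0 : ℝ) ≤ j := by positivity
  have hy : (0 : ℝ) ≤ k := by positivity
  generalize (j : ℝ) = x at *
  generalize (k : ℝ) = y at *
  generalize (N : ℝ) = z at *
  have hz : 0 ≤ z := by linarith
  have : 0 ≤ (x * y) * (4 * (x * y) * (x + y + z) + z * (x + y) * (x + y)) := by positivity
  nlinarith

/-- event rate; events are `(i, j, k)`: `k` units move from an `i`-cluster to a `j`-cluster -/
noncomputable def rate (a : ℕ → ℕ → ℕ → ℝ) (e : ℕ × ℕ × ℕ) : ℝ :=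
  if 1 ≤ e.2.2 ∧ e.2.2 ≤ e.1 then a e.1 e.2.1 e.2.2 else 0

/-- finite box of events -/
def box (n : ℕ) : Finset (ℕ × ℕ × ℕ) := range (n + 1) ×ˢ range (n + 1) ×ˢ range (n + 1)

lemma mem_box {n : ℕ} {e : ℕ × ℕ × ℕ} : e ∈ box n ↔ e.1 ≤ n ∧ e.2.1 ≤ n ∧ e.2.2 ≤ n := by
  simp [box]

lemma box_mono {m n : ℕ} (h : m ≤ n) : box m ⊆ box n := by
  intro e; simp only [mem_box]; omega

/-- change of the `l`-th component -/
noncomputable def jump (l : ℕ) (e : ℕ × ℕ × ℕ) : ℝ :=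
  if l = 0 then 0 else
    (if e.1 - e.2.2 = l then 1 else 0) - (if e.2.1 = l then 1 else 0) +
    (if e.2.1 + e.2.2 = l then 1 else 0) - (if e.1 = l then 1 else 0)

lemma jump_abs (l : ℕ) (e : ℕ × ℕ × ℕ) : |jump l e| ≤ 4 := by
  unfold jump
  split_ifs <;> norm_num

lemma sum_jump (w : ℕ → ℝ) (hw : w 0 = 0) (n : ℕ) (e : ℕ × ℕ × ℕ) (he : e ∈ box n) :
    ∑ l ∈ range (2 * n + 1), w l * jump l e =
      w (e.1 - e.2.2) - w e.2.1 + w (e.2.1 + e.2.2) - w e.1 := by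
  rw [mem_box] at he
  have : ∀ l ∈ range (2 * n + 1), w l * jump l e =
    (if e.1 - e.2.2 = l then w l else 0) - (if e.2.1 = l then w l else 0) +
    (if e.2.1 + e.2.2 = l then w l else 0) - (if e.1 = l then w l else 0) := by
    intro l _
    unfold jump
    by_cases hl : l = 0
    · subst hl; simp [hw]
    · simp only [hl, if_false, mul_add, mul_sub, mul_ite, mul_one, mul_zero]
  rw [sum_congr rfl this, sum_sub_distrib, sum_add_distrib, sum_sub_distrib]
  simp only [sum_ite_eq, mem_range]
  rw [if_pos (by omega), if_pos (by omega), if_pos (by omega), if_pos (by omega)]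

/-- Vector field of the truncated system -/
noncomputable def F (a : ℕ → ℕ → ℕ → ℝ) (n : ℕ) (u : ℕ → ℝ) (l : ℕ) : ℝ :=
  ∑ e ∈ box n, jump l e * (rate a e * u e.1 * u e.2.1)

lemma sum_F (a : ℕ → ℕ → ℕ → ℝ) (n : ℕ) (u : ℕ → ℝ) (w : ℕ → ℝ) (hw : w 0 = 0) :
    ∑ l ∈ range (2 * n + 1), w l * F a n u l =
      ∑ e ∈ box n, (rate a e * u e.1 * u e.2.1) *
        (w (e.1 - e.2.2) - w e.2.1 + w (e.2.1 + e.2.2) - w e.1) := by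
  unfold F
  simp_rw [mul_sum]
  rw [sum_comm]
  refine sum_congr rfl fun e he => ?_
  rw [← sum_jump w hw n e he, mul_sum]
  refine sum_congr rfl fun l _ => by ring

/-- Euler scheme -/
noncomputable def eul (a : ℕ → ℕ → ℕ → ℝ) (c0 : ℕ → ℝ) (n : ℕ) (δ : ℝ) : ℕ → ℕ → ℝ
  | 0 => c0
  | p + 1 => fun l => eul a c0 n δ p l + δ * F a n (eul a c0 n δ p) l

/-- kernel -/
noncomputable def kap (q : ℕ → ℕ → ℝ) (i k : ℕ) : ℝ :=
  if 1 ≤ k ∧ k ≤ i then (k : ℝ) * ((i : ℝ) - k + 1) * q i k else 0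

/-- dominating rates -/
noncomputable def bet (C : ℝ) (q : ℕ → ℕ → ℝ) (N : ℕ) (e : ℕ × ℕ × ℕ) : ℝ :=
  2 * C * kap q e.1 e.2.2 * (e.2.1 * phi N e.1 + gw N e.2.1)

/-- fragmentation part of the rates -/
noncomputable def fr (a : ℕ → ℕ → ℕ → ℝ) (N : ℕ) (e : ℕ × ℕ × ℕ) : ℝ :=
  if e.2.1 = 0 ∧ N ≤ e.1 then rate a e else 0

section static
variable {a : ℕ → ℕ → ℕ → ℝ} {C Q : ℝ} {q : ℕ → ℕ → ℝ}

lemma rate_nonneg (ha : ∀ i j k, 0 ≤ a i j k) (e : ℕ × ℕ × ℕ) : 0 ≤ rate a e := by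
  unfold rate; split_ifs; exacts [ha _ _ _, le_rfl]

lemma fr_nonneg (ha : ∀ i j k, 0 ≤ a i j k) (N : ℕ) (e : ℕ × ℕ × ℕ) : 0 ≤ fr a N e := by
  unfold fr; split_ifs; exacts [rate_nonneg ha _, le_rfl]

lemma kap_nonneg (hGB : GB a C Q q) (i k : ℕ) : 0 ≤ kap q i k := by
  unfold kap
  split_ifs with h
  · have : (k : ℝ) ≤ i := by exact_mod_cast h.2
    exact mul_nonneg (mul_nonneg (by positivity) (by linarith)) (hGB.2.2.1 _ _)
  · exact le_rfl

lemma bet_nonneg (hGB : GB a C Q q) (N : ℕ) (e : ℕ × ℕ × ℕ) : 0 ≤ bet C q N e := by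
  have hC : 0 ≤ C := by linarith [hGB.1]
  have := kap_nonneg hGB e.1 e.2.2
  have := phi_nonneg N e.1
  have := gw_nonneg N e.2.1
  unfold bet; positivity

lemma kap_sum (hGB : GB a C Q q) (n i : ℕ) : ∑ k ∈ range (n + 1), kap q i k ≤ Q * i := by
  rcases Nat.eq_zero_or_pos i with rfl | hi
  · have : ∀ k ∈ range (n + 1), kap q 0 k = 0 := by
      intro k _; unfold kap; rw [if_neg (by omega)]
    rw [sum_congr rfl this]; simp
  · refine le_trans ?_ (hGB.2.2.2.1 i hi)
    unfold kap
    rw [← sum_filter]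
    refine sum_le_sum_of_subset_of_nonneg ?_ ?_
    · intro k; simp only [mem_filter, mem_Icc]; tauto
    · intro k hk _
      have := kap_nonneg hGB i k
      unfold kap at this
      rwa [if_pos (by simpa using hk)] at this

lemma rate_delta (ha : ∀ i j k, 0 ≤ a i j k) (hzero : ∀ p : ℕ, 1 ≤ p → a p 0 p = 0)
    (hGB : GB a C Q q) (N : ℕ) (hN : 1 ≤ N) (e : ℕ × ℕ × ℕ) :
    rate a e * (gw N (e.1 - e.2.2) - gw N e.2.1 + gw N (e.2.1 + e.2.2) - gw N e.1)
      ≤ bet C q N e - fr a N e / 6 := by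
  have hb := bet_nonneg hGB N e
  obtain ⟨i, j, k⟩ := e
  by_cases hv : 1 ≤ k ∧ k ≤ i
  swap
  · have : rate a (i, j, k) = 0 := by simp only [rate]; rw [if_neg hv]
    simp [fr, this]; exact hb
  obtain ⟨l, rfl⟩ : ∃ l, i = l + k := ⟨i - k, by omega⟩
  have hr : rate a (l + k, j, k) = a (l + k) j k := by simp only [rate]; rw [if_pos hv]
  simp only [Nat.add_sub_cancel]
  rcases Nat.eq_zero_or_pos j with rfl | hj
  · simp only [gw_zero, zero_add, sub_zero, fr]
    rw [hr]
    rcases Nat.eq_zero_or_pos l with rfl | hl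
    · have : a (0 + k) 0 k = 0 := by rw [zero_add]; exact hzero k hv.1
      rw [this]; simpa using hb
    · by_cases hNl : N ≤ l + k
      · rw [if_pos ⟨by trivial, hNl⟩]
        have h1 := gw_strict N hN l k hl hv.1 hNl
        have := ha (l + k) 0 k
        nlinarith
      · rw [if_neg (by tauto)]
        have h1 := gw_super N hN l k
        have := ha (l + k) 0 k
        nlinarith
  · have hf : fr a N (l + k, j, k) = 0 := by
      unfold fr; rw [if_neg]; simp; omega
    rw [hf, hr]
    have h1 := gw_super N hN l k
    have h2 := gw_super N hN j k
    have h3 := gw_bound N hN j k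
    have h4 := hGB.2.2.2.2 (l + k) j k hv.1 hv.2 hj
    have h0 := ha (l + k) j k
    have hq := hGB.2.2.1 (l + k) k
    have hC : 0 ≤ C := by linarith [hGB.1]
    have h5 := phi_mono N hN hv.2
    have e1 : ((l + k : ℕ) : ℝ) - k + 1 = l + 1 := by push_cast; ring
    rw [e1] at h4
    have hkap : kap q (l + k) k = k * (l + 1) * q (l + k) k := by
      unfold kap; rw [if_pos hv, e1]
    simp only [bet]
    rw [hkap]
    calc a (l + k) j k * (gw N l - gw N j + gw N (j + k) - gw N (l + k))
        ≤ a (l + k) j k * (gw N (j + k) - gw N j - gw N k) := by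
          apply mul_le_mul_of_nonneg_left _ h0; linarith
      _ ≤ (C * (l + 1) * (j + k) * q (l + k) k) * (gw N (j + k) - gw N j - gw N k) := by
          apply mul_le_mul_of_nonneg_right h4; linarith
      _ = (C * (l + 1) * q (l + k) k) * ((j + k) * (gw N (j + k) - gw N j - gw N k)) := by ring
      _ ≤ (C * (l + 1) * q (l + k) k) * (2 * (j * gw N k + k * gw N j)) := by
          apply mul_le_mul_of_nonneg_left h3; positivity
      _ ≤ (C * (l + 1) * q (l + k) k) * (2 * (j * (k * phi N (l + k)) + k * gw N j)) := by
          apply mul_le_mul_of_nonneg_left _ (by positivity)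
          unfold gw
          gcongr
      _ = _ := by ring

lemma rate_tail (ha : ∀ i j k, 0 ≤ a i j k)
    (hGB : GB a C Q q) (N : ℕ) (hN : 1 ≤ N) (e : ℕ × ℕ × ℕ) (he : e ∉ box N) :
    rate a e ≤ 2 * bet C q N e + fr a N e := by
  have hb := bet_nonneg hGB N e
  have hfn := fr_nonneg ha N e
  obtain ⟨i, j, k⟩ := e
  by_cases hv : 1 ≤ k ∧ k ≤ i
  swap
  · have : rate a (i, j, k) = 0 := by simp only [rate]; rw [if_neg hv]
    rw [this]; linarith
  rw [mem_box] at he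
  simp only at he
  rcases Nat.eq_zero_or_pos j with rfl | hj
  · have : fr a N (i, 0, k) = rate a (i, 0, k) := by
      unfold fr; rw [if_pos ⟨by trivial, by simp only; omega⟩]
    rw [this]; linarith
  · have hr : rate a (i, j, k) = a i j k := by simp only [rate]; rw [if_pos hv]
    have h4 := hGB.2.2.2.2 i j k hv.1 hv.2 hj
    have hq := hGB.2.2.1 i k
    have hC : 0 ≤ C := by linarith [hGB.1]
    have hkap : kap q i k = k * (i - k + 1) * q i k := by
      unfold kap; rw [if_pos hv]
    have hkn := kap_nonneg hGB i k
    have hj' : (1 : ℝ) ≤ j := by exact_mod_cast hj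
    have hk' : (1 : ℝ) ≤ k := by exact_mod_cast hv.1
    have hi' : (k : ℝ) ≤ i := by exact_mod_cast hv.2
    have h6 : (j : ℝ) ≤ 2 * (j * phi N i + gw N j) := by
      have p1 := phi_nonneg N i
      have p2 := phi_nonneg N j
      unfold gw
      have : 1 ≤ 2 * (phi N i + phi N j) := by
        rcases le_total N i with h | h
        · have := phi_half N hN h; linarith
        · have := phi_half N hN (show N ≤ j by omega); linarith
      nlinarith
    rw [hr]
    have : a i j k ≤ 2 * C * kap q i k * j := by
      refine h4.trans ?_
      rw [hkap]
      have : (j + k : ℝ) ≤ 2 * k * j := by nlinarith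
      calc C * ((i : ℝ) - k + 1) * (j + k) * q i k ≤ C * ((i : ℝ) - k + 1) * (2 * k * j) * q i k := by
            have : (0 : ℝ) ≤ (i : ℝ) - k + 1 := by linarith
            gcongr
        _ = _ := by ring
    have h7 : 2 * C * kap q i k * j ≤ 2 * C * kap q i k * (2 * (j * phi N i + gw N j)) := by
      gcongr
    have : 2 * bet C q N (i, j, k) = 2 * C * kap q i k * (2 * (j * phi N i + gw N j)) := by
      simp only [bet]; ring
    linarith

lemma bet_sum (hGB : GB a C Q q) (N n : ℕ) (u : ℕ → ℝ) (hu : ∀ i, 0 ≤ u i)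
    (M : ℝ) (hM : ∑ i ∈ range (2 * n + 1), (i : ℝ) * u i ≤ M) :
    ∑ e ∈ box n, bet C q N e * u e.1 * u e.2.1 ≤
      4 * C * Q * M * ∑ i ∈ range (2 * n + 1), gw N i * u i := by
  have hC : 0 ≤ C := by linarith [hGB.1]
  have hQ : 0 ≤ Q := by linarith [hGB.2.1]
  have hsub : range (n + 1) ⊆ range (2 * n + 1) := by
    intro i; simp only [mem_range]; omega
  set M1 := ∑ i ∈ range (n + 1), (i : ℝ) * u i with hM1
  set W1 := ∑ i ∈ range (n + 1), gw N i * u i with hW1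
  have hM1M : M1 ≤ M := le_trans (sum_le_sum_of_subset_of_nonneg hsub
    (fun i _ _ => mul_nonneg (by positivity) (hu i))) hM
  have hW1W : W1 ≤ ∑ i ∈ range (2 * n + 1), gw N i * u i := sum_le_sum_of_subset_of_nonneg hsub
    (fun i _ _ => mul_nonneg (gw_nonneg N i) (hu i))
  have hM10 : 0 ≤ M1 := sum_nonneg (fun i _ => mul_nonneg (by positivity) (hu i))
  have hW10 : 0 ≤ W1 := sum_nonneg (fun i _ => mul_nonneg (gw_nonneg N i) (hu i))
  have key : ∑ e ∈ box n, bet C q N e * u e.1 * u e.2.1 ≤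
      ∑ i ∈ range (n + 1), ∑ j ∈ range (n + 1),
        2 * C * Q * ((gw N i * u i) * (j * u j) + (i * u i) * (gw N j * u j)) := by
    unfold box
    rw [sum_product]
    refine sum_le_sum fun i _ => ?_
    rw [sum_product]
    refine sum_le_sum fun j _ => ?_
    have e1 : ∑ k ∈ range (n + 1), bet C q N (i, j, k) * u i * u j =
        (∑ k ∈ range (n + 1), kap q i k) * (2 * C * (j * phi N i + gw N j) * u i * u j) := by
      rw [sum_mul]
      refine sum_congr rfl fun k _ => ?_
      simp only [bet]; ring
    simp only
    rw [e1]
    have := phi_nonneg N i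
    have := gw_nonneg N j
    have := hu i
    have := hu j
    calc _ ≤ (Q * i) * (2 * C * (j * phi N i + gw N j) * u i * u j) := by
          apply mul_le_mul_of_nonneg_right (kap_sum hGB n i); positivity
      _ = _ := by simp only [gw]; ring
  refine key.trans ?_
  have e2 : ∑ i ∈ range (n + 1), ∑ j ∈ range (n + 1),
        2 * C * Q * ((gw N i * u i) * (j * u j) + (i * u i) * (gw N j * u j))
      = 4 * C * Q * (M1 * W1) := by
    simp_rw [← mul_sum, sum_add_distrib, ← mul_sum, ← sum_mul]
    rw [← hM1, ← hW1]; ring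
  rw [e2]
  calc 4 * C * Q * (M1 * W1) ≤ 4 * C * Q * (M * ∑ i ∈ range (2 * n + 1), gw N i * u i) := by
        have : 0 ≤ M := hM10.trans hM1M
        gcongr
    _ = _ := by ring

end static
section dynamic
variable {a : ℕ → ℕ → ℕ → ℝ} {C Q : ℝ} {q : ℕ → ℕ → ℝ} {c0 : ℕ → ℝ}

lemma eul_zero (n : ℕ) (δ : ℝ) : eul a c0 n δ 0 = c0 := rfl
lemma eul_succ (n : ℕ) (δ : ℝ) (p l : ℕ) :
    eul a c0 n δ (p + 1) l = eul a c0 n δ p l + δ * F a n (eul a c0 n δ p) l := rfl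

lemma eul_sum (n : ℕ) (δ : ℝ) (p l : ℕ) :
    eul a c0 n δ p l = c0 l + δ * ∑ r ∈ range p, F a n (eul a c0 n δ r) l := by
  induction p with
  | zero => simp [eul_zero]
  | succ p ih => rw [eul_succ, sum_range_succ, ih]; ring

lemma F_zero (n : ℕ) (u : ℕ → ℝ) : F a n u 0 = 0 := by
  unfold F; simp [jump]

lemma F_large (n : ℕ) (u : ℕ → ℝ) (l : ℕ) (hl : 2 * n < l) : F a n u l = 0 := by
  unfold F
  refine sum_eq_zero fun e he => ?_
  rw [mem_box] at he
  have : jump l e = 0 := by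
    unfold jump
    rw [if_neg (by omega), if_neg (by omega), if_neg (by omega), if_neg (by omega),
      if_neg (by omega)]
    simp
  rw [this, zero_mul]

lemma F_lower (ha : ∀ i j k, 0 ≤ a i j k) (n : ℕ) (u : ℕ → ℝ) (hu : ∀ i, 0 ≤ u i) (B : ℝ)
    (hB : ∀ i, u i ≤ B) (l : ℕ) :
    -(2 * B * (∑ e ∈ box n, rate a e) * u l) ≤ F a n u l := by
  have e1 : -(2 * B * (∑ e ∈ box n, rate a e) * u l) =
      ∑ e ∈ box n, -(2 * B * rate a e * u l) := by
    rw [sum_neg_distrib, mul_sum, sum_mul]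
  rw [e1]
  unfold F
  refine sum_le_sum fun e _ => ?_
  have hr := rate_nonneg ha e
  have hB0 : 0 ≤ B := (hu 0).trans (hB 0)
  have h1 : ∀ (i : Prop) [Decidable i], (0 : ℝ) ≤ if i then 1 else 0 := by intro i _; split_ifs <;> norm_num
  have key : ∀ i : ℕ, ∀ v : ℝ, 0 ≤ v → v ≤ B → (if i = l then (1 : ℝ) else 0) * (rate a e * u i * v)
      ≤ B * rate a e * u l := by
    intro i v hv hvB
    split_ifs with h
    · subst h
      rw [one_mul]
      calc rate a e * u i * v ≤ rate a e * u i * B := by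
            apply mul_le_mul_of_nonneg_left hvB (mul_nonneg hr (hu i))
        _ = _ := by ring
    · rw [zero_mul]; exact mul_nonneg (mul_nonneg hB0 hr) (hu l)
  have k1 := key e.1 (u e.2.1) (hu _) (hB _)
  have k2 := key e.2.1 (u e.1) (hu _) (hB _)
  have hn : 0 ≤ rate a e * u e.1 * u e.2.1 := mul_nonneg (mul_nonneg hr (hu _)) (hu _)
  unfold jump
  by_cases hl : l = 0
  · rw [if_pos hl, zero_mul]
    have := mul_nonneg (mul_nonneg hB0 hr) (hu l)
    linarith
  · rw [if_neg hl]
    have m1 := mul_nonneg (h1 (e.1 - e.2.2 = l)) hn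
    have m2 := mul_nonneg (h1 (e.2.1 + e.2.2 = l)) hn
    have : rate a e * u e.2.1 * u e.1 = rate a e * u e.1 * u e.2.1 := by ring
    rw [this] at k2
    linarith

structure Adm (c0 : ℕ → ℝ) (M : ℝ) : Prop where
  nonneg : ∀ i, 0 ≤ c0 i
  mass : ∀ n, ∑ i ∈ range n, (i : ℝ) * c0 i ≤ M

lemma Adm.M_nonneg {M : ℝ} (h : Adm c0 M) : 0 ≤ M := by simpa using h.mass 0

lemma le_of_mass {u : ℕ → ℝ} (hu : ∀ i, 0 ≤ u i) {n : ℕ} {M : ℝ}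
    (h : ∑ i ∈ range n, (i : ℝ) * u i ≤ M) {l : ℕ} (hl : 1 ≤ l) (hln : l < n) : u l ≤ M := by
  have h1 : (l : ℝ) * u l ≤ ∑ i ∈ range n, (i : ℝ) * u i :=
    single_le_sum (f := fun i : ℕ => (i : ℝ) * u i)
      (fun i _ => mul_nonneg (by positivity) (hu i)) (mem_range.2 hln)
  have : (1 : ℝ) ≤ l := by exact_mod_cast hl
  nlinarith [hu l]

lemma eul_inv (ha : ∀ i j k, 0 ≤ a i j k) {M : ℝ} (hc : Adm c0 M) (n : ℕ) (δ : ℝ) (hδ : 0 ≤ δ)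
    (hδ1 : δ * (2 * (c0 0 + M) * ∑ e ∈ box n, rate a e) ≤ 1) (p : ℕ) :
    (∀ l, 0 ≤ eul a c0 n δ p l) ∧ (∀ l, eul a c0 n δ p l ≤ c0 0 + M) ∧
    eul a c0 n δ p 0 = c0 0 ∧ ∑ i ∈ range (2 * n + 1), (i : ℝ) * eul a c0 n δ p i ≤ M ∧
    (∀ l, 2 * n < l → eul a c0 n δ p l = c0 l) := by
  have hM := hc.M_nonneg
  have h00 := hc.nonneg 0
  have bd : ∀ u : ℕ → ℝ, (∀ l, 0 ≤ u l) → u 0 = c0 0 →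
      ∑ i ∈ range (2 * n + 1), (i : ℝ) * u i ≤ M → (∀ l, 2 * n < l → u l = c0 l) →
      ∀ l, u l ≤ c0 0 + M := by
    intro u h1 h2 h3 h4 l
    rcases Nat.eq_zero_or_pos l with rfl | hl
    · linarith
    · by_cases hln : l < 2 * n + 1
      · have := le_of_mass h1 h3 hl hln; linarith
      · rw [h4 l (by omega)]
        have := le_of_mass hc.nonneg (hc.mass (l + 1)) hl (by omega); linarith
  induction p with
  | zero =>
    rw [eul_zero]
    exact ⟨hc.nonneg, bd c0 hc.nonneg rfl (hc.mass _) (fun _ _ => rfl), rfl, hc.mass _,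
      fun _ _ => rfl⟩
  | succ p ih =>
    obtain ⟨i1, i2, i3, i4, i5⟩ := ih
    have j1 : ∀ l, 0 ≤ eul a c0 n δ (p + 1) l := by
      intro l
      rw [eul_succ]
      have h := F_lower ha n _ i1 _ i2 l
      have h' := mul_le_mul_of_nonneg_left h hδ
      have hsec := mul_le_mul_of_nonneg_right hδ1 (i1 l)
      linarith
    have j3 : eul a c0 n δ (p + 1) 0 = c0 0 := by
      rw [eul_succ, F_zero, i3]; ring
    have j4 : ∑ i ∈ range (2 * n + 1), (i : ℝ) * eul a c0 n δ (p + 1) i ≤ M := by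
      have hF := sum_F a n (eul a c0 n δ p) (fun i => (i : ℝ)) (by simp)
      have hF0 : ∑ l ∈ range (2 * n + 1), (l : ℝ) * F a n (eul a c0 n δ p) l = 0 := by
        rw [hF]
        refine sum_eq_zero fun e _ => ?_
        by_cases hv : 1 ≤ e.2.2 ∧ e.2.2 ≤ e.1
        · push_cast [hv.2]; ring
        · simp [rate, hv]
      simp_rw [eul_succ, mul_add, sum_add_distrib]
      have : ∑ x ∈ range (2 * n + 1), (x : ℝ) * (δ * F a n (eul a c0 n δ p) x) =
        δ * ∑ l ∈ range (2 * n + 1), (l : ℝ) * F a n (eul a c0 n δ p) l := by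
        rw [mul_sum]; exact sum_congr rfl fun l _ => by ring
      rw [this, hF0]; linarith
    have j5 : ∀ l, 2 * n < l → eul a c0 n δ (p + 1) l = c0 l := by
      intro l hl
      rw [eul_succ, F_large n _ l hl, i5 l hl]; ring
    exact ⟨j1, bd _ j1 j3 j4 j5, j3, j4, j5⟩

lemma eul_moment (ha : ∀ i j k, 0 ≤ a i j k) (hzero : ∀ p : ℕ, 1 ≤ p → a p 0 p = 0)
    (hGB : GB a C Q q) {M : ℝ} (hc : Adm c0 M) (n : ℕ) (δ : ℝ) (hδ : 0 ≤ δ)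
    (hδ1 : δ * (2 * (c0 0 + M) * ∑ e ∈ box n, rate a e) ≤ 1) (N : ℕ) (hN : 1 ≤ N) (p : ℕ) :
    (∑ i ∈ range (2 * n + 1), gw N i * eul a c0 n δ p i) +
      δ / 6 * ∑ r ∈ range p, ∑ e ∈ box n, fr a N e * eul a c0 n δ r e.1 * eul a c0 n δ r e.2.1 ≤
    (1 + δ * (4 * C * Q * M)) ^ p * ∑ i ∈ range (2 * n + 1), gw N i * c0 i := by
  have hC : 0 ≤ C := by linarith [hGB.1]
  have hQ : 0 ≤ Q := by linarith [hGB.2.1]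
  have hM := hc.M_nonneg
  have hK : 0 ≤ δ * (4 * C * Q * M) := by positivity
  induction p with
  | zero => simp [eul_zero]
  | succ p ih =>
    obtain ⟨i1, i2, i3, i4, i5⟩ := eul_inv ha hc n δ hδ hδ1 p
    set u := eul a c0 n δ p with hu
    have hF := sum_F a n u (gw N) (gw_zero N)
    have hF2 : ∑ l ∈ range (2 * n + 1), gw N l * F a n u l ≤
        4 * C * Q * M * (∑ i ∈ range (2 * n + 1), gw N i * u i) -
          (∑ e ∈ box n, fr a N e * u e.1 * u e.2.1) / 6 := by
      rw [hF]
      have hb := bet_sum hGB N n u i1 M i4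
      have : ∑ e ∈ box n, (rate a e * u e.1 * u e.2.1) *
        (gw N (e.1 - e.2.2) - gw N e.2.1 + gw N (e.2.1 + e.2.2) - gw N e.1) ≤
        ∑ e ∈ box n, (bet C q N e * u e.1 * u e.2.1 - (fr a N e * u e.1 * u e.2.1) / 6) := by
        refine sum_le_sum fun e _ => ?_
        have h := mul_le_mul_of_nonneg_right (rate_delta ha hzero hGB N hN e)
          (mul_nonneg (i1 e.1) (i1 e.2.1))
        nlinarith [h]
      rw [sum_sub_distrib, ← sum_div] at this
      linarith
    have e1 : ∑ i ∈ range (2 * n + 1), gw N i * eul a c0 n δ (p + 1) i =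
        (∑ i ∈ range (2 * n + 1), gw N i * u i) +
          δ * ∑ l ∈ range (2 * n + 1), gw N l * F a n u l := by
      rw [mul_sum, ← sum_add_distrib]
      refine sum_congr rfl fun l _ => ?_
      rw [eul_succ]; ring
    rw [e1, sum_range_succ _ p, pow_succ]
    set W := ∑ i ∈ range (2 * n + 1), gw N i * u i
    set R := ∑ r ∈ range p, ∑ e ∈ box n, fr a N e * eul a c0 n δ r e.1 * eul a c0 n δ r e.2.1
      with hR
    have hR0 : 0 ≤ R := by
      refine sum_nonneg fun r _ => sum_nonneg fun e _ => ?_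
      have := (eul_inv ha hc n δ hδ hδ1 r).1
      exact mul_nonneg (mul_nonneg (fr_nonneg ha N e) (this _)) (this _)
    have h1 := mul_le_mul_of_nonneg_left hF2 hδ
    have h2 := mul_le_mul_of_nonneg_right ih (show 0 ≤ 1 + δ * (4 * C * Q * M) by linarith)
    have h3 : 0 ≤ δ / 6 * R * (δ * (4 * C * Q * M)) := by positivity
    linarith

/-- constant in tail estimate -/
noncomputable def Dc (K T : ℝ) : ℝ := (2 * K * T + 6) * Real.exp (K * T)

lemma eul_tail (ha : ∀ i j k, 0 ≤ a i j k) (hzero : ∀ p : ℕ, 1 ≤ p → a p 0 p = 0)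
    (hGB : GB a C Q q) {M : ℝ} (hc : Adm c0 M) (n : ℕ) (δ : ℝ) (hδ : 0 ≤ δ)
    (hδ1 : δ * (2 * (c0 0 + M) * ∑ e ∈ box n, rate a e) ≤ 1) (N : ℕ) (hN : 1 ≤ N)
    (ε : ℝ) (hε : ∑ i ∈ range (2 * n + 1), gw N i * c0 i ≤ ε) (p : ℕ) (T : ℝ)
    (hp : p * δ ≤ T) :
    δ * ∑ r ∈ range p, ∑ e ∈ box n \ box N,
      rate a e * eul a c0 n δ r e.1 * eul a c0 n δ r e.2.1 ≤ Dc (4 * C * Q * M) T * ε := by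
  have hC : 0 ≤ C := by linarith [hGB.1]
  have hQ : 0 ≤ Q := by linarith [hGB.2.1]
  have hM := hc.M_nonneg
  set K := 4 * C * Q * M with hKdef
  have hK : 0 ≤ K := by positivity
  have hpos := fun r => (eul_inv ha hc n δ hδ hδ1 r).1
  have hW0 : 0 ≤ ∑ i ∈ range (2 * n + 1), gw N i * c0 i :=
    sum_nonneg fun i _ => mul_nonneg (gw_nonneg N i) (hc.nonneg i)
  have hε0 : 0 ≤ ε := hW0.trans hε
  have hpow : ∀ r : ℕ, r ≤ p → (1 + δ * K) ^ r * ∑ i ∈ range (2 * n + 1), gw N i * c0 i ≤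
      Real.exp (K * T) * ε := by
    intro r hr
    have h1 : (1 + δ * K) ^ r ≤ Real.exp (K * T) := by
      calc (1 + δ * K) ^ r ≤ (Real.exp (δ * K)) ^ r := by
            apply pow_le_pow_left₀ (by positivity)
            linarith [Real.add_one_le_exp (δ * K)]
        _ = Real.exp (r * (δ * K)) := by rw [← Real.exp_nat_mul]
        _ ≤ _ := by
            apply Real.exp_le_exp.2
            have : (r : ℝ) * δ ≤ T := by
              refine le_trans ?_ hp
              have : (r : ℝ) ≤ p := by exact_mod_cast hr
              gcongr
            nlinarith
    have := Real.exp_nonneg (K * T)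
    gcongr
  have hfr0 : ∀ r, 0 ≤ ∑ e ∈ box n, fr a N e * eul a c0 n δ r e.1 * eul a c0 n δ r e.2.1 :=
    fun r => sum_nonneg fun e _ =>
      mul_nonneg (mul_nonneg (fr_nonneg ha N e) (hpos r _)) (hpos r _)
  have hstep : ∀ r ∈ range p, ∑ e ∈ box n \ box N,
      rate a e * eul a c0 n δ r e.1 * eul a c0 n δ r e.2.1 ≤
      2 * K * (Real.exp (K * T) * ε) +
        ∑ e ∈ box n, fr a N e * eul a c0 n δ r e.1 * eul a c0 n δ r e.2.1 := by
    intro r hr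
    have hm := eul_moment ha hzero hGB hc n δ hδ hδ1 N hN r
    have hm2 := hpow r (mem_range.1 hr).le
    have hR : 0 ≤ δ / 6 * ∑ s ∈ range r, ∑ e ∈ box n,
        fr a N e * eul a c0 n δ s e.1 * eul a c0 n δ s e.2.1 :=
      mul_nonneg (by positivity) (sum_nonneg fun s _ => hfr0 s)
    have hb := bet_sum hGB N n (eul a c0 n δ r) (hpos r) M (eul_inv ha hc n δ hδ hδ1 r).2.2.2.1
    calc ∑ e ∈ box n \ box N, rate a e * eul a c0 n δ r e.1 * eul a c0 n δ r e.2.1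
        ≤ ∑ e ∈ box n \ box N, (2 * bet C q N e + fr a N e) *
            (eul a c0 n δ r e.1 * eul a c0 n δ r e.2.1) := by
          refine sum_le_sum fun e he => ?_
          rw [mul_assoc]
          exact mul_le_mul_of_nonneg_right (rate_tail ha hGB N hN e (mem_sdiff.1 he).2)
            (mul_nonneg (hpos r _) (hpos r _))
      _ ≤ ∑ e ∈ box n, (2 * bet C q N e + fr a N e) *
            (eul a c0 n δ r e.1 * eul a c0 n δ r e.2.1) := by
          refine sum_le_sum_of_subset_of_nonneg sdiff_subset fun e _ _ => ?_
          have := bet_nonneg hGB N e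
          have := fr_nonneg ha N e
          have := hpos r e.1
          have := hpos r e.2.1
          positivity
      _ = 2 * (∑ e ∈ box n, bet C q N e * eul a c0 n δ r e.1 * eul a c0 n δ r e.2.1) +
          ∑ e ∈ box n, fr a N e * eul a c0 n δ r e.1 * eul a c0 n δ r e.2.1 := by
          rw [mul_sum, ← sum_add_distrib]
          exact sum_congr rfl fun e _ => by ring
      _ ≤ _ := by
          have h5 : ∑ i ∈ range (2 * n + 1), gw N i * eul a c0 n δ r i ≤ Real.exp (K * T) * ε := by
            linarith
          have := mul_le_mul_of_nonneg_left h5 hK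
          linarith
  have hm := eul_moment ha hzero hGB hc n δ hδ hδ1 N hN p
  have hm2 := hpow p le_rfl
  have hWp : 0 ≤ ∑ i ∈ range (2 * n + 1), gw N i * eul a c0 n δ p i :=
    sum_nonneg fun i _ => mul_nonneg (gw_nonneg N i) (hpos p i)
  have h6 := mul_le_mul_of_nonneg_left (sum_le_sum hstep) hδ
  rw [sum_add_distrib, sum_const, card_range, nsmul_eq_mul] at h6
  have hE : 0 ≤ Real.exp (K * T) * ε := mul_nonneg (Real.exp_nonneg _) hε0
  have h7 : (p * δ) * (2 * K * (Real.exp (K * T) * ε)) ≤ T * (2 * K * (Real.exp (K * T) * ε)) :=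
    mul_le_mul_of_nonneg_right hp (by positivity)
  unfold Dc
  linarith

end dynamic
section limits
open Filter Topology

lemma tsum_integrable {α ι : Type*} [MeasurableSpace α] {μ : Measure α} [Countable ι]
    {f : ι → α → ℝ} (hf : ∀ i, Integrable (f i) μ) (hs : Summable fun i => ∫ x, ‖f i x‖ ∂μ) :
    (∀ᵐ x ∂μ, Summable fun i => f i x) ∧ Integrable (fun x => ∑' i, f i x) μ := by
  have h1 : ∑' i, ∫⁻ x, ‖f i x‖ₑ ∂μ ≠ ⊤ := by
    have (i : ι) : ∫⁻ a, ‖f i a‖ₑ ∂μ = ENNReal.ofReal (∫ a, ‖f i a‖ ∂μ) := by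
      rw [ofReal_integral_norm_eq_lintegral_enorm (hf i)]
    simp_rw [this]
    exact hs.tsum_ofReal_ne_top
  have hae : ∀ i, AEMeasurable (fun x => ‖f i x‖ₑ) μ := fun i => (hf i).1.enorm
  rw [← lintegral_tsum hae] at h1
  have h2 : ∀ᵐ x ∂μ, Summable fun i => f i x := by
    filter_upwards [ae_lt_top' (AEMeasurable.tsum hae) h1] with x hx
    exact (tsum_enorm_ne_top_iff_summable_norm.1 hx.ne).of_norm
  refine ⟨h2, ?_, ?_⟩
  · refine aestronglyMeasurable_of_tendsto_ae (u := (atTop : Filter (Finset ι)))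
      (f := fun s x => ∑ i ∈ s, f i x) (fun s => ?_) ?_
    · exact Finset.aestronglyMeasurable_fun_sum s fun i _ => (hf i).1
    · filter_upwards [h2] with x hx using hx.hasSum
  · refine lt_of_le_of_lt (lintegral_mono fun x => ?_) (lt_top_iff_ne_top.2 h1)
    exact enorm_tsum_le_tsum_enorm

lemma tail_limit {E : Type*} [DecidableEq E] (X : ℕ → E → ℝ) (x : E → ℝ) (Bx : ℕ → Finset E)
    (hX : ∀ n e, 0 ≤ X n e) (hlim : ∀ e, Tendsto (fun n => X n e) atTop (𝓝 (x e)))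
    (htail : ∀ η > 0, ∃ S : Finset E, ∀ n, ∑ e ∈ Bx n \ S, X n e ≤ η)
    (hBx : ∀ e, ∀ᶠ n in atTop, e ∈ Bx n) :
    Summable x ∧ ∀ b : E → ℝ, (∀ e, |b e| ≤ 4) →
      Tendsto (fun n => ∑ e ∈ Bx n, b e * X n e) atTop (𝓝 (∑' e, b e * x e)) := by
  have hx : ∀ e, 0 ≤ x e := fun e => ge_of_tendsto' (hlim e) fun n => hX n e
  have hsum : Summable x := by
    obtain ⟨S, hS⟩ := htail 1 one_pos
    refine summable_of_sum_le (c := ∑ e ∈ S, x e + 1) hx fun U => ?_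
    have h1 : ∑ e ∈ U, x e ≤ ∑ e ∈ S, x e + ∑ e ∈ U \ S, x e := by
      calc ∑ e ∈ U, x e ≤ ∑ e ∈ S ∪ (U \ S), x e := by
            refine sum_le_sum_of_subset_of_nonneg ?_ fun e _ _ => hx e
            intro e he
            by_cases h : e ∈ S <;> simp [h, he]
        _ = _ := sum_union disjoint_sdiff
    have h2 : ∑ e ∈ U \ S, x e ≤ 1 := by
      refine le_of_tendsto (tendsto_finsetSum (U \ S) fun e _ => hlim e) ?_
      have : ∀ᶠ n in atTop, ∀ e ∈ U, e ∈ Bx n := by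
        rw [eventually_all_finset]; exact fun e _ => hBx e
      filter_upwards [this] with n hn
      refine le_trans (sum_le_sum_of_subset_of_nonneg ?_ fun e _ _ => hX n e) (hS n)
      intro e he
      rw [Finset.mem_sdiff] at he ⊢
      exact ⟨hn e he.1, he.2⟩
    linarith
  refine ⟨hsum, fun b hb => ?_⟩
  have hbx : Summable fun e => b e * x e := by
    refine Summable.of_norm_bounded (hsum.mul_left 4) fun e => ?_
    rw [norm_mul, Real.norm_of_nonneg (hx e)]
    exact mul_le_mul_of_nonneg_right (hb e) (hx e)
  rw [Metric.tendsto_atTop']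
  intro η hη
  obtain ⟨S, hS⟩ := htail (η / 16) (by positivity)
  have hev := (Metric.tendsto_nhds.1 hbx.hasSum (η / 4) (by positivity))
  obtain ⟨U, hU, hSU⟩ := (hev.and (eventually_ge_atTop S)).exists
  have hlimU : Tendsto (fun n => ∑ e ∈ U, b e * X n e) atTop (𝓝 (∑ e ∈ U, b e * x e)) :=
    tendsto_finsetSum U fun e _ => (hlim e).const_mul _
  have h3 := Metric.tendsto_nhds.1 hlimU (η / 4) (by positivity)
  have h4 : ∀ᶠ n in atTop, ∀ e ∈ U, e ∈ Bx n := by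
    rw [eventually_all_finset]; exact fun e _ => hBx e
  obtain ⟨n0, hn0⟩ := eventually_atTop.1 (h3.and h4)
  refine ⟨n0, fun n hn => ?_⟩
  obtain ⟨k1, k2⟩ := hn0 n (le_of_lt hn)
  have hsplit : ∑ e ∈ Bx n, b e * X n e =
      ∑ e ∈ Bx n \ U, b e * X n e + ∑ e ∈ U, b e * X n e :=
    (sum_sdiff (show U ⊆ Bx n from k2)).symm
  have hsm : |∑ e ∈ Bx n \ U, b e * X n e| ≤ η / 4 := by
    calc |∑ e ∈ Bx n \ U, b e * X n e| ≤ ∑ e ∈ Bx n \ U, |b e * X n e| := abs_sum_le_sum_abs _ _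
      _ ≤ ∑ e ∈ Bx n \ U, 4 * X n e := by
          refine sum_le_sum fun e _ => ?_
          rw [abs_mul, abs_of_nonneg (hX n e)]
          exact mul_le_mul_of_nonneg_right (hb e) (hX n e)
      _ ≤ ∑ e ∈ Bx n \ S, 4 * X n e := by
          refine sum_le_sum_of_subset_of_nonneg (sdiff_subset_sdiff le_rfl hSU) fun e _ _ => ?_
          have := hX n e; positivity
      _ = 4 * ∑ e ∈ Bx n \ S, X n e := by rw [mul_sum]
      _ ≤ η / 4 := by linarith [hS n]
  rw [Real.dist_eq] at *
  rw [hsplit]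
  rw [abs_lt] at *
  rw [abs_le] at hsm
  constructor <;> linarith [hsm.1, hsm.2, hU.1, hU.2, k1.1, k1.2]

lemma extract (v : ℕ → ℕ → ℝ → ℝ) (B : ℝ) (hv : ∀ n i t, v n i t ∈ Set.Icc 0 B)
    (hmod : ∀ i : ℕ, ∀ T : ℝ, ∀ ε > 0, ∃ η > 0, ∃ n0 : ℕ, ∀ n ≥ n0, ∀ s t : ℝ,
      0 ≤ s → s ≤ t → t ≤ T → t - s < η → |v n i t - v n i s| ≤ ε) :
    ∃ φ : ℕ → ℕ, StrictMono φ ∧ ∃ c : ℕ → ℝ → ℝ,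
      (∀ i, ∀ t, 0 ≤ t → Tendsto (fun n => v (φ n) i t) atTop (𝓝 (c i t))) ∧
      ∀ i, ContinuousOn (c i) (Set.Ici 0) := by
  have hK : IsCompact (Set.univ.pi fun _ : ℕ × ℚ => Set.Icc (0 : ℝ) B) :=
    isCompact_univ_pi fun _ => isCompact_Icc
  obtain ⟨L, -, φ, hφ, hL⟩ := hK.isSeqCompact
    (x := fun n (z : ℕ × ℚ) => v n z.1 (z.2 : ℝ)) (fun n z _ => hv n z.1 z.2)
  rw [tendsto_pi_nhds] at hL
  have hc : ∀ i, ∀ t, 0 ≤ t → ∃ l, Tendsto (fun n => v (φ n) i t) atTop (𝓝 l) := by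
    intro i t ht
    apply cauchySeq_tendsto_of_complete
    rw [Metric.cauchySeq_iff]
    intro ε hε
    obtain ⟨η, hη, n0, hn0⟩ := hmod i (t + 1) (ε / 4) (by positivity)
    obtain ⟨r, hr1, hr2⟩ := exists_rat_btwn (show t < min (t + η) (t + 1) by
      rw [lt_min_iff]; constructor <;> linarith)
    rw [lt_min_iff] at hr2
    have hcr : CauchySeq fun n => v (φ n) i (r : ℝ) := (hL (i, r)).cauchySeq
    obtain ⟨n1, hn1⟩ := Metric.cauchySeq_iff.1 hcr (ε / 4) (by positivity)
    refine ⟨max n0 n1, fun m hm n hn => ?_⟩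
    have a1 := hn0 (φ m) (le_trans (le_trans (le_max_left _ _) hm) (hφ.id_le m)) t r ht hr1.le
      hr2.2.le (by linarith)
    have a2 := hn0 (φ n) (le_trans (le_trans (le_max_left _ _) hn) (hφ.id_le n)) t r ht hr1.le
      hr2.2.le (by linarith)
    have a3 := hn1 m (le_trans (le_max_right _ _) hm) n (le_trans (le_max_right _ _) hn)
    rw [Real.dist_eq] at *
    rw [abs_lt] at *
    rw [abs_le] at a1 a2
    constructor <;> linarith [a1.1, a1.2, a2.1, a2.2, a3.1, a3.2]
  choose c hc using hc
  refine ⟨φ, hφ, fun i t => if h : 0 ≤ t then c i t h else 0, ?_, ?_⟩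
  · intro i t ht
    simp only [ht, dif_pos]
    exact hc i t ht
  · intro i t ht
    rw [Metric.continuousWithinAt_iff]
    intro ε hε
    obtain ⟨η, hη, n0, hn0⟩ := hmod i (t + 1) (ε / 2) (by positivity)
    refine ⟨min η 1, lt_min hη one_pos, ?_⟩
    intro s hs hst
    have ht' : 0 ≤ t := ht
    have hs' : 0 ≤ s := hs
    simp only [ht', hs', dif_pos]
    rw [Real.dist_eq] at *
    rw [lt_min_iff, abs_lt, abs_lt] at hst
    have hlim := ((hc i s hs').sub (hc i t ht')).abs
    refine lt_of_le_of_lt (le_of_tendsto hlim ?_) (half_lt_self hε)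
    filter_upwards [eventually_ge_atTop n0] with n hn
    have hn' : n0 ≤ φ n := le_trans hn (hφ.id_le n)
    rcases le_total s t with h | h
    · rw [abs_sub_comm]
      exact hn0 _ hn' s t hs' h (by linarith) (by linarith)
    · exact hn0 _ hn' t s ht' h (by linarith [hst.2.2]) (by linarith)

lemma step_intervalIntegrable (g : ℕ → ℝ) (B : ℝ) (hg : ∀ r, |g r| ≤ B) (δ : ℝ) (x y : ℝ) :
    IntervalIntegrable (fun s => g ⌊s / δ⌋₊) volume x y := by
  have hm : Measurable fun s : ℝ => g ⌊s / δ⌋₊ :=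
    (measurable_from_top (f := g)).comp (Nat.measurable_floor.comp (measurable_id.div_const δ))
  refine (intervalIntegrable_const (c := B)).mono_fun hm.aestronglyMeasurable ?_
  refine Eventually.of_forall fun s => ?_
  have h := hg ⌊s / δ⌋₊
  have : 0 ≤ B := (abs_nonneg _).trans h
  simpa [abs_of_nonneg this] using h

lemma step_integral (g : ℕ → ℝ) (B : ℝ) (hg : ∀ r, |g r| ≤ B) (δ : ℝ) (hδ : 0 < δ) (p : ℕ) :
    ∫ s in (0 : ℝ)..(p * δ), g ⌊s / δ⌋₊ = δ * ∑ r ∈ range p, g r := by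
  have h := intervalIntegral.sum_integral_adjacent_intervals (μ := volume)
    (f := fun s => g ⌊s / δ⌋₊) (a := fun r : ℕ => (r : ℝ) * δ) (n := p)
    (fun k _ => step_intervalIntegrable g B hg δ _ _)
  simp only [Nat.cast_zero, zero_mul] at h
  rw [← h, mul_sum]
  refine sum_congr rfl fun r _ => ?_
  have hle : (r : ℝ) * δ ≤ ((r + 1 : ℕ) : ℝ) * δ := by push_cast; nlinarith
  have : ∫ s in (r : ℝ) * δ..((r + 1 : ℕ) : ℝ) * δ, g ⌊s / δ⌋₊ =
      ∫ s in (r : ℝ) * δ..((r + 1 : ℕ) : ℝ) * δ, g r := by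
    rw [intervalIntegral.integral_of_le hle, intervalIntegral.integral_of_le hle,
      integral_Ioc_eq_integral_Ioo, integral_Ioc_eq_integral_Ioo]
    refine setIntegral_congr_fun measurableSet_Ioo fun s hs => ?_
    have : ⌊s / δ⌋₊ = r := by
      rw [Nat.floor_eq_iff (div_nonneg (le_trans (by positivity) hs.1.le) hδ.le)]
      constructor
      · rw [le_div_iff₀ hδ]; exact hs.1.le
      · rw [div_lt_iff₀ hδ]; have := hs.2; push_cast at this; exact this
    simp only [this]
  rw [this, intervalIntegral.integral_const, smul_eq_mul]
  push_cast; ring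

lemma step_limit (g : ℕ → ℕ → ℝ) (B : ℝ) (hg : ∀ n r, |g n r| ≤ B) (δ : ℕ → ℝ)
    (hδ : ∀ n, 0 < δ n) (hδ0 : Tendsto δ atTop (𝓝 0)) (f : ℝ → ℝ) (t : ℝ) (ht : 0 ≤ t)
    (hf : ∀ s, 0 ≤ s → Tendsto (fun n => g n ⌊s / δ n⌋₊) atTop (𝓝 (f s))) :
    Tendsto (fun n => δ n * ∑ r ∈ range ⌊t / δ n⌋₊, g n r) atTop (𝓝 (∫ s in (0 : ℝ)..t, f s)) := by
  have hB : 0 ≤ B := (abs_nonneg _).trans (hg 0 0)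
  have h1 : Tendsto (fun n => ∫ s in (0 : ℝ)..t, g n ⌊s / δ n⌋₊) atTop
      (𝓝 (∫ s in (0 : ℝ)..t, f s)) := by
    refine intervalIntegral.tendsto_integral_filter_of_dominated_convergence (fun _ => B) ?_ ?_ ?_ ?_
    · refine Eventually.of_forall fun n => ?_
      have hm : Measurable fun s : ℝ => g n ⌊s / δ n⌋₊ :=
        (measurable_from_top (f := g n)).comp
          (Nat.measurable_floor.comp (measurable_id.div_const (δ n)))
      exact hm.aestronglyMeasurable
    · refine Eventually.of_forall fun n => Eventually.of_forall fun s _ => hg n _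
    · exact intervalIntegrable_const
    · refine Eventually.of_forall fun s hs => hf s ?_
      rw [Set.uIoc_of_le ht] at hs
      exact hs.1.le
  have h2 : Tendsto (fun n => ∫ s in ((⌊t / δ n⌋₊ : ℝ) * δ n)..t, g n ⌊s / δ n⌋₊) atTop (𝓝 0) := by
    refine squeeze_zero_norm (a := fun n => B * δ n) (fun n => ?_) (by simpa using hδ0.const_mul B)
    have hfl1 : (⌊t / δ n⌋₊ : ℝ) * δ n ≤ t := by
      rw [← le_div_iff₀ (hδ n)]; exact Nat.floor_le (div_nonneg ht (hδ n).le)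
    have hfl2 : t ≤ ((⌊t / δ n⌋₊ : ℝ) + 1) * δ n := by
      rw [← div_le_iff₀ (hδ n)]; exact (Nat.lt_floor_add_one _).le
    refine (intervalIntegral.norm_integral_le_of_norm_le_const (C := B) fun s _ => hg n _).trans ?_
    rw [abs_of_nonneg (by linarith)]
    exact mul_le_mul_of_nonneg_left (by linarith) hB
  have h3 := h1.sub h2
  rw [sub_zero] at h3
  refine h3.congr fun n => ?_
  have := intervalIntegral.integral_add_adjacent_intervals
    (step_intervalIntegrable (g n) B (hg n) (δ n) 0 ((⌊t / δ n⌋₊ : ℝ) * δ n))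
    (step_intervalIntegrable (g n) B (hg n) (δ n) ((⌊t / δ n⌋₊ : ℝ) * δ n) t)
  rw [← this, step_integral (g n) B (hg n) (δ n) (hδ n)]
  ring

end limits
section ident
variable {a : ℕ → ℕ → ℕ → ℝ}

/-- event flux -/
noncomputable def flux (a : ℕ → ℕ → ℕ → ℝ) (c : ℕ → ℝ) (e : ℕ × ℕ × ℕ) : ℝ :=
  rate a e * c e.1 * c e.2.1

/-- indicator -/
noncomputable def b1 (l : ℕ) (e : ℕ × ℕ × ℕ) : ℝ := if e.1 - e.2.2 = l then 1 else 0
noncomputable def b2 (l : ℕ) (e : ℕ × ℕ × ℕ) : ℝ := if e.2.1 = l then 1 else 0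
noncomputable def b3 (l : ℕ) (e : ℕ × ℕ × ℕ) : ℝ := if e.2.1 + e.2.2 = l then 1 else 0
noncomputable def b4 (l : ℕ) (e : ℕ × ℕ × ℕ) : ℝ := if e.1 = l then 1 else 0

lemma jump_eq {l : ℕ} (hl : 1 ≤ l) (e : ℕ × ℕ × ℕ) :
    jump l e = b1 l e - b2 l e + b3 l e - b4 l e := by
  unfold jump b1 b2 b3 b4; rw [if_neg (by omega)]

lemma b1_abs (l : ℕ) (e : ℕ × ℕ × ℕ) : |b1 l e| ≤ 4 := by unfold b1; split_ifs <;> norm_num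
lemma b2_abs (l : ℕ) (e : ℕ × ℕ × ℕ) : |b2 l e| ≤ 4 := by unfold b2; split_ifs <;> norm_num
lemma b3_abs (l : ℕ) (e : ℕ × ℕ × ℕ) : |b3 l e| ≤ 4 := by unfold b3; split_ifs <;> norm_num
lemma b4_abs (l : ℕ) (e : ℕ × ℕ × ℕ) : |b4 l e| ≤ 4 := by unfold b4; split_ifs <;> norm_num

lemma summable_b {f b : ℕ × ℕ × ℕ → ℝ} (hf : Summable f) (hb : ∀ e, |b e| ≤ 4) :
    Summable fun e => b e * f e := by
  refine Summable.of_norm_bounded (hf.abs.mul_left 4) fun e => ?_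
  rw [norm_mul]
  exact mul_le_mul_of_nonneg_right (hb e) (abs_nonneg _)

variable {c : ℕ → ℝ} {l : ℕ}

lemma ident1 (hl : 1 ≤ l) (hs : Summable (flux a c)) :
    Summable (fun p : ℕ × ℕ =>
      if 1 ≤ p.1 then a (l + p.1) p.2 p.1 * c (l + p.1) * c p.2 else 0) ∧
    Qi1 a c l = ∑' e, b1 l e * flux a c e := by
  let g : ℕ × ℕ → ℕ × ℕ × ℕ := fun p => (l + p.1, p.2, p.1)
  have hg : Function.Injective g := by
    rintro ⟨x, y⟩ ⟨x', y'⟩ h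
    simp only [g, Prod.mk.injEq] at h ⊢
    omega
  have hterm : ∀ p : ℕ × ℕ, b1 l (g p) * flux a c (g p) =
      if 1 ≤ p.1 then a (l + p.1) p.2 p.1 * c (l + p.1) * c p.2 else 0 := by
    intro p
    simp only [g, b1, flux, rate, Nat.add_sub_cancel, if_true, one_mul]
    by_cases h : 1 ≤ p.1
    · rw [if_pos ⟨h, by omega⟩, if_pos h]
    · rw [if_neg (by tauto), if_neg h]; ring
  have h1 := (summable_b hs (b1_abs l)).comp_injective hg
  constructor
  · refine h1.congr fun p => ?_
    rw [← hterm]; rfl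
  · unfold Qi1
    rw [← hg.tsum_eq (f := fun e => b1 l e * flux a c e)]
    · exact tsum_congr fun p => (hterm p).symm
    · intro e he
      rw [Function.mem_support] at he
      by_cases h : e.1 - e.2.2 = l
      · refine ⟨(e.2.2, e.2.1), ?_⟩
        ext <;> simp [g]
        omega
      · simp [b1, h] at he

lemma ident2 (hs : Summable (flux a c)) :
    Summable (fun p : ℕ × ℕ =>
      if 1 ≤ p.1 ∧ p.1 ≤ p.2 then a p.2 l p.1 * c p.2 * c l else 0) ∧
    Qi2 a c l = -∑' e, b2 l e * flux a c e := by
  let g : ℕ × ℕ → ℕ × ℕ × ℕ := fun p => (p.2, l, p.1)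
  have hg : Function.Injective g := by
    rintro ⟨x, y⟩ ⟨x', y'⟩ h
    simp only [g, Prod.mk.injEq] at h ⊢
    omega
  have hterm : ∀ p : ℕ × ℕ, b2 l (g p) * flux a c (g p) =
      if 1 ≤ p.1 ∧ p.1 ≤ p.2 then a p.2 l p.1 * c p.2 * c l else 0 := by
    intro p
    simp only [g, b2, flux, rate, if_true, one_mul]
    by_cases h : 1 ≤ p.1 ∧ p.1 ≤ p.2
    · rw [if_pos h, if_pos h]
    · rw [if_neg h, if_neg h]; ring
  have h1 := (summable_b hs (b2_abs l)).comp_injective hg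
  constructor
  · refine h1.congr fun p => ?_
    rw [← hterm]; rfl
  · unfold Qi2
    rw [← hg.tsum_eq (f := fun e => b2 l e * flux a c e)]
    · exact congrArg Neg.neg (tsum_congr fun p => (hterm p).symm)
    · intro e he
      rw [Function.mem_support] at he
      by_cases h : e.2.1 = l
      · refine ⟨(e.2.2, e.1), ?_⟩
        ext <;> simp [g, h]
      · simp [b2, h] at he

lemma ident3 (hs : Summable (flux a c)) :
    (∀ k ∈ Finset.Icc 1 l,
      Summable (fun j : ℕ => if k ≤ j then a j (l - k) k * c j * c (l - k) else 0)) ∧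
    Qi3 a c l = ∑' e, b3 l e * flux a c e := by
  let g : ℕ × ℕ → ℕ × ℕ × ℕ := fun p => (p.2, l - p.1, p.1)
  have hg : Function.Injective g := by
    rintro ⟨x, y⟩ ⟨x', y'⟩ h
    simp only [g, Prod.mk.injEq] at h ⊢
    omega
  have hterm : ∀ k ∈ Finset.Icc 1 l, ∀ j : ℕ, b3 l (g (k, j)) * flux a c (g (k, j)) =
      if k ≤ j then a j (l - k) k * c j * c (l - k) else 0 := by
    intro k hk j
    rw [mem_Icc] at hk
    simp only [g, b3, flux, rate]
    rw [if_pos (by omega), one_mul]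
    by_cases h : k ≤ j
    · rw [if_pos ⟨hk.1, h⟩, if_pos h]
    · rw [if_neg (by tauto), if_neg h]; ring
  have h1 := (summable_b hs (b3_abs l)).comp_injective hg
  constructor
  · intro k hk
    refine (h1.comp_injective (Prod.mk_right_injective k)).congr fun j => ?_
    rw [← hterm k hk]; rfl
  · unfold Qi3
    rw [← hg.tsum_eq (f := fun e => b3 l e * flux a c e)]
    · rw [Summable.tsum_prod (f := fun p => b3 l (g p) * flux a c (g p)) h1, tsum_eq_sum (s := Finset.Icc 1 l)]
      · exact sum_congr rfl fun k hk => tsum_congr fun j => (hterm k hk j).symm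
      · intro k hk
        rw [mem_Icc] at hk
        rw [← tsum_zero (β := ℕ)]
        refine tsum_congr fun j => ?_
        simp only [g, b3, flux, rate, Function.comp]
        by_cases h : 1 ≤ k
        · rw [if_neg (by omega)]; ring
        · rw [if_neg (c := 1 ≤ k ∧ k ≤ j) (by tauto)]; ring
    · intro e he
      rw [Function.mem_support] at he
      by_cases h : e.2.1 + e.2.2 = l
      · refine ⟨(e.2.2, e.1), ?_⟩
        ext <;> simp [g]
        omega
      · simp [b3, h] at he

lemma ident4 (hs : Summable (flux a c)) :
    (∀ k ∈ Finset.Icc 1 l, Summable (fun j : ℕ => a l j k * c j * c l)) ∧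
    Qi4 a c l = -∑' e, b4 l e * flux a c e := by
  let g : ℕ × ℕ → ℕ × ℕ × ℕ := fun p => (l, p.2, p.1)
  have hg : Function.Injective g := by
    rintro ⟨x, y⟩ ⟨x', y'⟩ h
    simp only [g, Prod.mk.injEq] at h ⊢
    omega
  have hterm : ∀ k ∈ Finset.Icc 1 l, ∀ j : ℕ, b4 l (g (k, j)) * flux a c (g (k, j)) =
      a l j k * c j * c l := by
    intro k hk j
    rw [mem_Icc] at hk
    simp only [g, b4, flux, rate]
    rw [if_pos trivial, if_pos hk]; ring
  have h1 := (summable_b hs (b4_abs l)).comp_injective hg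
  constructor
  · intro k hk
    refine (h1.comp_injective (Prod.mk_right_injective k)).congr fun j => ?_
    rw [← hterm k hk]; rfl
  · unfold Qi4
    rw [← hg.tsum_eq (f := fun e => b4 l e * flux a c e)]
    · rw [Summable.tsum_prod (f := fun p => b4 l (g p) * flux a c (g p)) h1, tsum_eq_sum (s := Finset.Icc 1 l)]
      · exact congrArg Neg.neg
          (sum_congr rfl fun k hk => tsum_congr fun j => (hterm k hk j).symm)
      · intro k hk
        rw [mem_Icc] at hk
        rw [← tsum_zero (β := ℕ)]
        refine tsum_congr fun j => ?_
        simp only [g, b4, flux, rate, Function.comp]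
        rw [if_neg (c := 1 ≤ k ∧ k ≤ l) hk]; ring
    · intro e he
      rw [Function.mem_support] at he
      by_cases h : e.1 = l
      · refine ⟨(e.2.2, e.2.1), ?_⟩
        ext <;> simp [g, h]
      · simp [b4, h] at he

lemma ident_all (hl : 1 ≤ l) (hs : Summable (flux a c)) :
    Qi1 a c l + Qi2 a c l + Qi3 a c l + Qi4 a c l = ∑' e, jump l e * flux a c e := by
  have s1 := summable_b hs (b1_abs l)
  have s2 := summable_b hs (b2_abs l)
  have s3 := summable_b hs (b3_abs l)
  have s4 := summable_b hs (b4_abs l)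
  rw [(ident1 hl hs).2, (ident2 hs).2, (ident3 hs).2, (ident4 hs).2]
  simp_rw [jump_eq hl, sub_mul, add_mul, sub_mul]
  rw [((s1.sub s2).add s3).tsum_sub s4, (s1.sub s2).tsum_add s3, s1.tsum_sub s2]
  ring

end ident
section final
open Filter Topology

lemma eps_tendsto {c0 : ℕ → ℝ} (hc0 : ∀ i, 0 ≤ c0 i) (hs : Summable fun i : ℕ => (i : ℝ) * c0 i) :
    Tendsto (fun N : ℕ => ∑' i, gw N i * c0 i) atTop (𝓝 0) := by
  have h := tendsto_tsum_of_dominated_convergence (𝓕 := (atTop : Filter ℕ))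
    (f := fun N i => gw N i * c0 i) (g := fun _ => (0 : ℝ)) hs ?_ ?_
  · simpa using h
  · intro i
    have h1 : Tendsto (fun N : ℕ => phi N i) atTop (𝓝 0) := by
      unfold phi
      refine Tendsto.div_atTop tendsto_const_nhds ?_
      exact tendsto_atTop_add_const_left _ _ tendsto_natCast_atTop_atTop
    have := (h1.const_mul (i : ℝ)).mul_const (c0 i)
    simpa [gw] using this
  · refine Eventually.of_forall fun N i => ?_
    rw [Real.norm_of_nonneg (mul_nonneg (gw_nonneg N i) (hc0 i))]
    exact mul_le_mul_of_nonneg_right (gw_le N i) (hc0 i)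

/-- Summary of the properties of the approximating sequence -/
structure Appr (a : ℕ → ℕ → ℕ → ℝ) (c0 : ℕ → ℝ) (B M : ℝ) (D : ℝ → ℝ) (ε : ℕ → ℝ) (δ : ℕ → ℝ)
    (u : ℕ → ℕ → ℕ → ℝ) : Prop where
  δpos : ∀ n, 0 < δ n
  δlim : Tendsto δ atTop (𝓝 0)
  εlim : Tendsto ε atTop (𝓝 0)
  init : ∀ n, u n 0 = c0
  nonneg : ∀ n p l, 0 ≤ u n p l
  le : ∀ n p l, u n p l ≤ B
  zero : ∀ n p, u n p 0 = c0 0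
  mass : ∀ n p, ∑ i ∈ range (2 * n + 1), (i : ℝ) * u n p i ≤ M
  eq : ∀ n p l, u n p l = c0 l + δ n * ∑ r ∈ range p, ∑ e ∈ box n, jump l e * flux a (u n r) e
  tail : ∀ n N, 1 ≤ N → ∀ (T : ℝ) (p : ℕ), (p : ℝ) * δ n ≤ T →
    δ n * ∑ r ∈ range p, ∑ e ∈ box n \ box N, flux a (u n r) e ≤ D T * ε N

lemma exists_appr {a : ℕ → ℕ → ℕ → ℝ} (ha : ∀ i j k, 0 ≤ a i j k)
    (hzero : ∀ p : ℕ, 1 ≤ p → a p 0 p = 0)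
    {C Q : ℝ} {q : ℕ → ℕ → ℝ} (hGB : GB a C Q q)
    {c0 : ℕ → ℝ} (hc0 : ∀ i, 0 ≤ c0 i)
    (hX : Summable (fun i : ℕ => (1 + (i : ℝ)) * c0 i)) :
    ∃ B M D ε δ u, Appr a c0 B M D ε δ u := by
  have hs : Summable fun i : ℕ => (i : ℝ) * c0 i := by
    refine Summable.of_nonneg_of_le (fun i => mul_nonneg (by positivity) (hc0 i)) (fun i => ?_) hX
    have := hc0 i
    nlinarith
  set M := ∑' i : ℕ, (i : ℝ) * c0 i with hM
  have hc : Adm c0 M := ⟨hc0, fun n => hs.sum_le_tsum _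
    (fun i _ => mul_nonneg (by positivity) (hc0 i))⟩
  have hM0 := hc.M_nonneg
  have hS : ∀ n, 0 ≤ 2 * (c0 0 + M) * ∑ e ∈ box n, rate a e := fun n =>
    mul_nonneg (by linarith [hc0 0]) (sum_nonneg fun e _ => rate_nonneg ha e)
  set δ : ℕ → ℝ := fun n => 1 / ((n : ℝ) + 1 + 2 * (c0 0 + M) * ∑ e ∈ box n, rate a e) with hδ
  have hδpos : ∀ n, 0 < δ n := fun n => by have := hS n; simp only [hδ]; positivity
  have hδ1 : ∀ n, δ n * (2 * (c0 0 + M) * ∑ e ∈ box n, rate a e) ≤ 1 := by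
    intro n
    have := hS n
    simp only [hδ]
    rw [div_mul_eq_mul_div, one_mul, div_le_one (by positivity)]
    have : (0 : ℝ) ≤ n := by positivity
    linarith
  have inv := fun n p => eul_inv ha hc n (δ n) (hδpos n).le (hδ1 n) p
  refine ⟨c0 0 + M, M, Dc (4 * C * Q * M), fun N => ∑' i, gw N i * c0 i, δ,
    fun n => eul a c0 n (δ n), hδpos, ?_, eps_tendsto hc0 hs, fun n => rfl, fun n p => (inv n p).1,
    fun n p => (inv n p).2.1, fun n p => (inv n p).2.2.1, fun n p => (inv n p).2.2.2.1,
    fun n p l => eul_sum n (δ n) p l, ?_⟩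
  · refine squeeze_zero (fun n => (hδpos n).le) (fun n => ?_) tendsto_one_div_add_atTop_nhds_zero_nat
    have := hS n
    simp only [hδ]
    apply one_div_le_one_div_of_le (by positivity)
    linarith
  · intro n N hN T p hp
    have hsg : Summable fun i => gw N i * c0 i :=
      Summable.of_nonneg_of_le (fun i => mul_nonneg (gw_nonneg N i) (hc0 i))
        (fun i => mul_le_mul_of_nonneg_right (gw_le N i) (hc0 i)) hs
    exact eul_tail ha hzero hGB hc n (δ n) (hδpos n).le (hδ1 n) N hN _
      (hsg.sum_le_tsum _ (fun i _ => mul_nonneg (gw_nonneg N i) (hc0 i))) p T hp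

section consequences
variable {a : ℕ → ℕ → ℕ → ℝ} {c0 : ℕ → ℝ} {B M : ℝ} {D : ℝ → ℝ} {ε : ℕ → ℝ} {δ : ℕ → ℝ}
  {u : ℕ → ℕ → ℕ → ℝ}

lemma flux_nonneg (ha : ∀ i j k, 0 ≤ a i j k) {c : ℕ → ℝ} (hc : ∀ i, 0 ≤ c i) (e : ℕ × ℕ × ℕ) :
    0 ≤ flux a c e := mul_nonneg (mul_nonneg (rate_nonneg ha e) (hc _)) (hc _)

lemma flux_le (ha : ∀ i j k, 0 ≤ a i j k) {c : ℕ → ℝ} (hc : ∀ i, 0 ≤ c i) (hB : ∀ i, c i ≤ B)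
    (e : ℕ × ℕ × ℕ) : flux a c e ≤ rate a e * B * B := by
  have h0 : 0 ≤ B := (hc 0).trans (hB 0)
  have := rate_nonneg ha e
  have := hc e.1
  have := hc e.2.1
  unfold flux
  exact mul_le_mul (mul_le_mul_of_nonneg_left (hB _) (by positivity)) (hB _) (by positivity)
    (by positivity)

lemma floor_mul_le {t d : ℝ} (ht : 0 ≤ t) (hd : 0 < d) : (⌊t / d⌋₊ : ℝ) * d ≤ t := by
  rw [← le_div_iff₀ hd]; exact Nat.floor_le (div_nonneg ht hd.le)

lemma Appr.modulus (ha : ∀ i j k, 0 ≤ a i j k) (h : Appr a c0 B M D ε δ u) (n l N : ℕ)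
    (hN : 1 ≤ N) (T s t : ℝ) (hs : 0 ≤ s) (hst : s ≤ t) (htT : t ≤ T) :
    |u n ⌊t / δ n⌋₊ l - u n ⌊s / δ n⌋₊ l| ≤
      4 * ((∑ e ∈ box N, rate a e * B * B) * (t - s + δ n)) + 4 * (D T * ε N) := by
  have hd := h.δpos n
  set p := ⌊s / δ n⌋₊ with hp
  set p' := ⌊t / δ n⌋₊ with hp'
  have hpp : p ≤ p' := Nat.floor_le_floor (by gcongr)
  have hfn : ∀ r e, 0 ≤ flux a (u n r) e := fun r e => flux_nonneg ha (h.nonneg n r) e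
  have hSN : 0 ≤ ∑ e ∈ box N, rate a e * B * B := sum_nonneg fun e _ => by
    have := rate_nonneg ha e
    have := (h.nonneg 0 0 0).trans (h.le 0 0 0)
    positivity
  have e1 : u n p' l - u n p l = δ n * ∑ r ∈ Ico p p', ∑ e ∈ box n, jump l e * flux a (u n r) e := by
    rw [h.eq n p' l, h.eq n p l, sum_Ico_eq_sub _ hpp]; ring
  have e2 : ∀ r, |∑ e ∈ box n, jump l e * flux a (u n r) e| ≤
      4 * (∑ e ∈ box N, rate a e * B * B) + 4 * ∑ e ∈ box n \ box N, flux a (u n r) e := by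
    intro r
    calc |∑ e ∈ box n, jump l e * flux a (u n r) e|
        ≤ ∑ e ∈ box n, |jump l e * flux a (u n r) e| := abs_sum_le_sum_abs _ _
      _ ≤ ∑ e ∈ box n, 4 * flux a (u n r) e := by
          refine sum_le_sum fun e _ => ?_
          rw [abs_mul, abs_of_nonneg (hfn r e)]
          exact mul_le_mul_of_nonneg_right (jump_abs l e) (hfn r e)
      _ ≤ ∑ e ∈ box N ∪ (box n \ box N), 4 * flux a (u n r) e := by
          refine sum_le_sum_of_subset_of_nonneg ?_ fun e _ _ => by have := hfn r e; positivity
          intro e he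
          by_cases hh : e ∈ box N <;> simp [hh, he]
      _ = 4 * (∑ e ∈ box N, flux a (u n r) e) + 4 * ∑ e ∈ box n \ box N, flux a (u n r) e := by
          rw [sum_union disjoint_sdiff, mul_sum, mul_sum]
      _ ≤ _ := by
          gcongr with e he
          exact flux_le ha (h.nonneg n r) (h.le n r) e
  have ht0 : 0 ≤ t := hs.trans hst
  have hps : (p' : ℝ) * δ n ≤ t := floor_mul_le ht0 hd
  have hps2 : s ≤ ((p : ℝ) + 1) * δ n := by
    rw [← div_le_iff₀ hd]; exact (Nat.lt_floor_add_one _).le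
  have htail := h.tail n N hN T p' (hps.trans htT)
  rw [e1, abs_mul, abs_of_pos hd]
  calc δ n * |∑ r ∈ Ico p p', ∑ e ∈ box n, jump l e * flux a (u n r) e|
      ≤ δ n * ∑ r ∈ Ico p p', (4 * (∑ e ∈ box N, rate a e * B * B) +
          4 * ∑ e ∈ box n \ box N, flux a (u n r) e) := by
        apply mul_le_mul_of_nonneg_left _ hd.le
        exact (abs_sum_le_sum_abs _ _).trans (sum_le_sum fun r _ => e2 r)
    _ = 4 * ((∑ e ∈ box N, rate a e * B * B) * (((p' : ℝ) - p) * δ n)) +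
        4 * (δ n * ∑ r ∈ Ico p p', ∑ e ∈ box n \ box N, flux a (u n r) e) := by
        rw [sum_add_distrib, sum_const, Nat.card_Ico, nsmul_eq_mul, Nat.cast_sub hpp, ← mul_sum]
        ring
    _ ≤ _ := by
        have h1 : ∑ r ∈ Ico p p', ∑ e ∈ box n \ box N, flux a (u n r) e ≤
            ∑ r ∈ range p', ∑ e ∈ box n \ box N, flux a (u n r) e := by
          refine sum_le_sum_of_subset_of_nonneg ?_ fun r _ _ => sum_nonneg fun e _ => hfn r e
          intro r; simp
        have h2 := mul_le_mul_of_nonneg_left h1 hd.le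
        have h3 : ((p' : ℝ) - p) * δ n ≤ t - s + δ n := by linarith
        have h4 := mul_le_mul_of_nonneg_left h3 hSN
        linarith

lemma small_eps (h : Appr a c0 B M D ε δ u) (T : ℝ) {η : ℝ} (hη : 0 < η) :
    ∃ N, 1 ≤ N ∧ D T * ε N ≤ η := by
  have h1 : Tendsto (fun N => D T * ε N) atTop (𝓝 0) := by simpa using h.εlim.const_mul (D T)
  have h2 := h1.eventually (ge_mem_nhds hη)
  obtain ⟨N, hN⟩ := (h2.and (eventually_ge_atTop 1)).exists
  exact ⟨N, hN.2, hN.1⟩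

theorem Appr.solution (ha : ∀ i j k, 0 ≤ a i j k) (h : Appr a c0 B M D ε δ u)
    (hc0 : ∀ i, 0 ≤ c0 i) : ∃ c : ℕ → ℝ → ℝ, MildSolNon a c0 (Set.Ici 0) c := by
  have hM0 : 0 ≤ M := (sum_nonneg fun i _ => mul_nonneg (by positivity) (h.nonneg 0 0 i)).trans
    (h.mass 0 0)
  have hB0 : 0 ≤ B := (h.nonneg 0 0 0).trans (h.le 0 0 0)
  obtain ⟨φ, hφ, c, hlim, hcont⟩ := extract (fun n l t => u n ⌊t / δ n⌋₊ l) B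
    (fun n l t => ⟨h.nonneg _ _ _, h.le _ _ _⟩) (by
      intro l T η hη
      obtain ⟨N, hN, hsm⟩ := small_eps h T (show 0 < η / 16 by positivity)
      set S := ∑ e ∈ box N, rate a e * B * B with hS
      have hSN : 0 ≤ S := sum_nonneg fun e _ => by
        have := rate_nonneg ha e
        positivity
      set θ := η / (16 * (S + 1)) with hθ
      have hθ0 : 0 < θ := by positivity
      have hθ1 : S * θ ≤ η / 16 := by
        rw [hθ, ← mul_div_assoc, div_le_div_iff₀ (by positivity) (by positivity)]
        nlinarith
      obtain ⟨n0, hn0⟩ := eventually_atTop.1 (h.δlim.eventually (gt_mem_nhds hθ0))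
      refine ⟨θ, hθ0, n0, fun n hn s t hs hst htT hts => ?_⟩
      refine (h.modulus ha n l N hN T s t hs hst htT).trans ?_
      have h1 := hn0 n hn
      have h2 : S * (t - s + δ n) ≤ S * (θ + θ) := mul_le_mul_of_nonneg_left (by linarith) hSN
      rw [← hS]
      linarith)
  have hcn : ∀ i t, 0 ≤ t → 0 ≤ c i t := fun i t ht =>
    ge_of_tendsto' (hlim i t ht) fun n => h.nonneg _ _ _
  have hzero' : ∀ t, 0 ≤ t → c 0 t = c0 0 := fun t ht =>
    tendsto_nhds_unique (hlim 0 t ht) (by simp only [h.zero]; exact tendsto_const_nhds)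
  -- per-event limits
  set x : ℝ → ℕ × ℕ × ℕ → ℝ := fun t e => ∫ s in (0 : ℝ)..t, flux a (fun m => c m s) e with hx
  have hδφ : Tendsto (fun n => δ (φ n)) atTop (𝓝 0) := h.δlim.comp hφ.tendsto_atTop
  have hXlim : ∀ t, 0 ≤ t → ∀ e, Tendsto (fun n => δ (φ n) *
      ∑ r ∈ range ⌊t / δ (φ n)⌋₊, flux a (u (φ n) r) e) atTop (𝓝 (x t e)) := by
    intro t ht e
    refine step_limit (fun n r => flux a (u (φ n) r) e) (rate a e * B * B) (fun n r => ?_)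
      (fun n => δ (φ n)) (fun n => h.δpos _) hδφ _ t ht (fun s hs => ?_)
    · rw [abs_of_nonneg (flux_nonneg ha (h.nonneg _ _) e)]
      exact flux_le ha (h.nonneg _ _) (h.le _ _) e
    · unfold flux
      exact ((hlim e.1 s hs).const_mul _).mul (hlim e.2.1 s hs)
  have hboth : ∀ t, 0 ≤ t → Summable (x t) ∧ ∀ b : ℕ × ℕ × ℕ → ℝ, (∀ e, |b e| ≤ 4) →
      Tendsto (fun n => ∑ e ∈ box (φ n), b e * (δ (φ n) *
        ∑ r ∈ range ⌊t / δ (φ n)⌋₊, flux a (u (φ n) r) e)) atTop (𝓝 (∑' e, b e * x t e)) := by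
    intro t ht
    refine tail_limit _ (x t) (fun n => box (φ n)) (fun n e => ?_) (hXlim t ht) ?_ ?_
    · exact mul_nonneg (h.δpos _).le (sum_nonneg fun r _ => flux_nonneg ha (h.nonneg _ _) e)
    · intro η hη
      obtain ⟨N, hN, hsm⟩ := small_eps h t hη
      refine ⟨box N, fun n => ?_⟩
      rw [← mul_sum, sum_comm]
      exact (h.tail (φ n) N hN t _ (floor_mul_le ht (h.δpos _))).trans hsm
    · intro e
      filter_upwards [eventually_ge_atTop (max e.1 (max e.2.1 e.2.2))] with n hn
      have := hφ.id_le n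
      simp only [id] at this
      rw [mem_box]
      omega
  have heq : ∀ l t, 0 ≤ t → c l t = c0 l + ∑' e, jump l e * x t e := by
    intro l t ht
    refine tendsto_nhds_unique (hlim l t ht) ?_
    refine (((hboth t ht).2 (jump l) (jump_abs l)).const_add (c0 l)).congr fun n => ?_
    rw [h.eq, sum_comm, mul_sum]
    congr 1
    refine sum_congr rfl fun e _ => ?_
    rw [← mul_sum]; ring
  refine ⟨c, ?_, ?_, hcont, fun t ht => hzero' t ht, ?_⟩
  · intro i
    refine tendsto_nhds_unique (hlim i 0 le_rfl) ?_
    simp only [zero_div, Nat.floor_zero, h.init]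
    exact tendsto_const_nhds
  · intro t ht
    refine ⟨fun i => hcn i t ht, ?_⟩
    refine summable_of_sum_range_le (c := B + 2 * M)
      (fun i => mul_nonneg (by positivity) (hcn i t ht)) fun m => ?_
    refine le_of_tendsto (tendsto_finsetSum (range m) fun i _ => (hlim i t ht).const_mul _) ?_
    filter_upwards [eventually_ge_atTop m] with n hn
    have hmn : m ≤ φ n := hn.trans (hφ.id_le n)
    set w := u (φ n) ⌊t / δ (φ n)⌋₊ with hw
    have hwn : ∀ i, 0 ≤ w i := h.nonneg _ _
    calc ∑ i ∈ range m, (1 + (i : ℝ)) * w i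
        ≤ ∑ i ∈ range (2 * φ n + 1), (1 + (i : ℝ)) * w i := by
          refine sum_le_sum_of_subset_of_nonneg ?_ fun i _ _ => mul_nonneg (by positivity) (hwn i)
          intro i; simp only [mem_range]; omega
      _ ≤ ∑ i ∈ range (2 * φ n + 1), ((if 0 = i then w i else 0) + 2 * ((i : ℝ) * w i)) := by
          refine sum_le_sum fun i _ => ?_
          split_ifs with hi
          · subst hi; simp
          · have : (1 : ℝ) ≤ i := by exact_mod_cast Nat.one_le_iff_ne_zero.2 (Ne.symm hi)
            have := hwn i
            nlinarith
      _ = w 0 + 2 * ∑ i ∈ range (2 * φ n + 1), (i : ℝ) * w i := by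
          rw [sum_add_distrib, sum_ite_eq, if_pos (by simp), mul_sum]
      _ ≤ B + 2 * M := by
          have h1 := h.le (φ n) ⌊t / δ (φ n)⌋₊ 0
          have h2 := h.mass (φ n) ⌊t / δ (φ n)⌋₊
          rw [← hw] at h1 h2
          linarith
  · intro l hl t ht
    have ht' : 0 ≤ t := ht
    set μ := volume.restrict (Set.Ioc 0 t) with hμ
    have hfi : ∀ e, Integrable (fun s => flux a (fun m => c m s) e) μ := by
      intro e
      have hco : ContinuousOn (fun s => flux a (fun m => c m s) e) (Set.Icc 0 t) := by
        have h1 := (hcont e.1).mono (Set.Icc_subset_Ici_self : Set.Icc 0 t ⊆ Set.Ici 0)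
        have h2 := (hcont e.2.1).mono (Set.Icc_subset_Ici_self : Set.Icc 0 t ⊆ Set.Ici 0)
        unfold flux
        exact (continuousOn_const.mul h1).mul h2
      exact (hco.integrableOn_Icc).mono_set Set.Ioc_subset_Icc_self
    have hxe : ∀ e, x t e = ∫ s, flux a (fun m => c m s) e ∂μ := fun e =>
      intervalIntegral.integral_of_le ht'
    have hnorm : ∀ e, ∫ s, ‖flux a (fun m => c m s) e‖ ∂μ = x t e := by
      intro e
      rw [hxe]
      refine setIntegral_congr_fun measurableSet_Ioc fun s hs => ?_
      exact Real.norm_of_nonneg (flux_nonneg ha (fun m => hcn m s hs.1.le) e)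
    have hsx := (hboth t ht').1
    have hsn : Summable fun e => ∫ s, ‖flux a (fun m => c m s) e‖ ∂μ := by
      simp_rw [hnorm]; exact hsx
    have hae := (tsum_integrable hfi hsn).1
    have hbi : ∀ b : ℕ × ℕ × ℕ → ℝ, (∀ e, |b e| ≤ 4) →
        (∀ e, Integrable (fun s => b e * flux a (fun m => c m s) e) μ) ∧
        Summable fun e => ∫ s, ‖b e * flux a (fun m => c m s) e‖ ∂μ := by
      intro b hb
      refine ⟨fun e => (hfi e).const_mul _, ?_⟩
      simp_rw [norm_mul, integral_const_mul, hnorm]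
      exact summable_b (b := fun e => ‖b e‖) hsx (fun e => by simpa using hb e)
    have hI := fun b hb => (tsum_integrable (hbi b hb).1 (hbi b hb).2).2
    refine ⟨?_, ?_, ?_, ?_, ?_, ?_⟩
    · filter_upwards [hae] with s hs
      exact ⟨(ident1 hl hs).1, (ident2 hs).1, (ident3 hs).1, (ident4 hs).1⟩
    · refine (hI (b1 l) (b1_abs l)).congr ?_
      filter_upwards [hae] with s hs using (ident1 hl hs).2.symm
    · refine (hI (b2 l) (b2_abs l)).neg.congr ?_
      filter_upwards [hae] with s hs using (ident2 hs).2.symm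
    · refine (hI (b3 l) (b3_abs l)).congr ?_
      filter_upwards [hae] with s hs using (ident3 hs).2.symm
    · refine (hI (b4 l) (b4_abs l)).neg.congr ?_
      filter_upwards [hae] with s hs using (ident4 hs).2.symm
    · rw [heq l t ht', intervalIntegral.integral_of_le ht', ← hμ]
      congr 1
      have hj := integral_tsum_of_summable_integral_norm (hbi (jump l) (jump_abs l)).1
        (hbi (jump l) (jump_abs l)).2
      simp_rw [integral_const_mul, ← hxe] at hj
      rw [hj]
      refine integral_congr_ae ?_
      filter_upwards [hae] with s hs using (ident_all hl hs).symm

end consequences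
end final
end DGED

/-- Theorem 5.3: existence of a global mild solution of the non-isolated DGED system. -/
theorem exists_global_mild_solution_nonisolated
    (a : ℕ → ℕ → ℕ → ℝ) (ha : ∀ i j k, 0 ≤ a i j k)
    (hzero : ∀ p : ℕ, 1 ≤ p → a p 0 p = 0)
    (C Q : ℝ) (q : ℕ → ℕ → ℝ) (hGB : GB a C Q q)
    (c0 : ℕ → ℝ) (hc0 : ∀ i, 0 ≤ c0 i)
    (hX : Summable (fun i : ℕ => (1 + (i : ℝ)) * c0 i)) :
    ∃ c : ℕ → ℝ → ℝ, MildSolNon a c0 (Set.Ici 0) c := by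
  obtain ⟨B, M, D, ε, δ, u, h⟩ := DGED.exists_appr ha hzero hGB hc0 hX
  exact h.solution ha hc0
end
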